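/- arXiv:1311.3297 — 4 statements merged into one kernel-verified Lean document; each statement's English description precedes it below -/
import Mathlib

section
/- Let H_A and H_B be positive semidefinite Hermitian operators on a finite-dimensional complex inner product space, let S denote the kernel of H_A, and suppose S ≠ {0}. Let c, d > 0 and suppose that every nonzero eigenvalue of the compression H_B|_S of H_B to S is at least c, and that every nonzero eigenvalue of H_A is at least d. Then every nonzero eigenvalue of H_A + H_B is at least cd/(c + d + ‖H_B‖), where ‖·‖ denotes the operator norm. (Nullspace Projection Lemma.) -/
/-- Spectral gap: a symmetric operator whose nonzero eigenvalues are at least `c` satisfies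
`c ‖x‖² ≤ ⟨T x, x⟩` on the orthogonal complement of its kernel. -/
lemma npl_gap {E : Type*} [NormedAddCommGroup E] [InnerProductSpace ℂ E] [FiniteDimensional ℂ E]
    (T : E →ₗ[ℂ] E) (hT : T.IsSymmetric) (c : ℝ)
    (h : ∀ μ : ℝ, Module.End.HasEigenvalue T (μ : ℂ) → μ ≠ 0 → c ≤ μ)
    (x : E) (hx : ∀ w, T w = 0 → inner ℂ w x = 0) :
    c * ‖x‖ ^ 2 ≤ (inner ℂ (T x) x).re := by
  set b := hT.eigenvectorBasis rfl with hb
  rw [← b.sum_sq_norm_inner_right x, ← b.sum_inner_mul_inner (T x) x, Complex.re_sum,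
    Finset.mul_sum]
  refine Finset.sum_le_sum fun i _ => ?_
  have h1 : inner ℂ (T x) (b i) = (hT.eigenvalues rfl i : ℂ) * inner ℂ x (b i) := by
    rw [hT x (b i), hb, hT.apply_eigenvectorBasis, inner_smul_right]
    rfl
  have h2 : (inner ℂ (T x) (b i) * inner ℂ (b i) x).re
      = hT.eigenvalues rfl i * ‖inner ℂ (b i) x‖ ^ 2 := by
    rw [h1, mul_assoc, Complex.re_ofReal_mul, inner_mul_symm_re_eq_norm (𝕜 := ℂ) x (b i) |> fun h => (show (inner ℂ x (b i) * inner ℂ (b i) x).re = _ from h), norm_mul,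
      norm_inner_symm x (b i), sq]
  rw [h2]
  by_cases h0 : hT.eigenvalues rfl i = 0
  · have : inner ℂ (b i) x = 0 := by
      apply hx
      rw [hb, hT.apply_eigenvectorBasis, h0]
      simp
    simp [this]
  · exact mul_le_mul_of_nonneg_right (h _ (hT.hasEigenvalue_eigenvalues rfl i) h0) (sq_nonneg _)

/-- Expansion of the quadratic form of a symmetric operator. -/
lemma npl_expand {E : Type*} [NormedAddCommGroup E] [InnerProductSpace ℂ E]
    (T : E →L[ℂ] E) (hT : T.IsPositive) (a : ℝ) (x y : E) :
    (inner ℂ (T ((a : ℂ) • x + y)) ((a : ℂ) • x + y)).re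
      = a ^ 2 * (inner ℂ (T x) x).re + 2 * a * (inner ℂ (T x) y).re + (inner ℂ (T y) y).re := by
  have h : (inner ℂ (T y) x).re = (inner ℂ (T x) y).re := by
    rw [hT.inner_left_eq_inner_right y x, ← inner_conj_symm, Complex.conj_re]
  simp only [map_add, map_smul, inner_add_left, inner_add_right, inner_smul_left,
    inner_smul_right, Complex.add_re, Complex.conj_ofReal, Complex.re_ofReal_mul, h]
  ring

/-- A null vector of the quadratic form of a positive operator is in the kernel. -/
lemma npl_null {E : Type*} [NormedAddCommGroup E] [InnerProductSpace ℂ E]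
    (T : E →L[ℂ] E) (hT : T.IsPositive) (w : E) (hw : (inner ℂ (T w) w).re = 0) : T w = 0 := by
  by_contra hne
  have hn : 0 < ‖T w‖ ^ 2 := by positivity
  have hs : (inner ℂ (T w) (T w)).re = ‖T w‖ ^ 2 := inner_self_eq_norm_sq (𝕜 := ℂ) (T w)
  have hq : 0 ≤ (inner ℂ (T (T w)) (T w)).re := hT.re_inner_nonneg_left (T w)
  set q := (inner ℂ (T (T w)) (T w)).re with hqd
  set a : ℝ := -(q + 1) / ‖T w‖ ^ 2 with ha
  have h1 : 0 ≤ (inner ℂ (T ((a : ℂ) • w + T w)) ((a : ℂ) • w + T w)).re :=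
    hT.re_inner_nonneg_left _
  rw [npl_expand T hT, hw, hs, ← hqd] at h1
  have h2 : a * ‖T w‖ ^ 2 = -(q + 1) := by rw [ha]; field_simp
  nlinarith


/-- **Nullspace Projection Lemma.**  Let `H_A` and `H_B` be positive
semidefinite Hermitian operators on a finite-dimensional complex inner product space, let
`S` denote the kernel of `H_A`, and suppose `S ≠ {0}`.  Let `c, d > 0` and suppose that
every nonzero eigenvalue of the compression `H_B|_S` of `H_B` to `S` is at least `c`, and
that every nonzero eigenvalue of `H_A` is at least `d`.  Then every nonzero eigenvalue of
`H_A + H_B` is at least `cd/(c + d + ‖H_B‖)`.  (The compression `H_B|_S` is the operator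
on `S` given by `x ↦ P_S (H_B x)` with `P_S` the orthogonal projection onto `S`; being
positive semidefinite operators, all operators involved have real eigenvalues.) -/
theorem nullspace_projection_lemma
    {E : Type*} [NormedAddCommGroup E] [InnerProductSpace ℂ E] [FiniteDimensional ℂ E]
    (HA HB : E →L[ℂ] E) (hHA : HA.IsPositive) (hHB : HB.IsPositive)
    (S : Submodule ℂ E) (hS : S = LinearMap.ker HA.toLinearMap) (hSne : S ≠ ⊥)
    (c d : ℝ) (hc : 0 < c) (hd : 0 < d)
    (hcomp : ∀ μ : ℝ, Module.End.HasEigenvalue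
        (((S.orthogonalProjectionOnto).comp (HB.comp S.subtypeL)).toLinearMap) (μ : ℂ) →
        μ ≠ 0 → c ≤ μ)
    (hA : ∀ μ : ℝ, Module.End.HasEigenvalue (HA.toLinearMap) (μ : ℂ) → μ ≠ 0 → d ≤ μ) :
    ∀ μ : ℝ, Module.End.HasEigenvalue ((HA + HB).toLinearMap) (μ : ℂ) → μ ≠ 0 →
      c * d / (c + d + ‖HB‖) ≤ μ := by
  intro μ hμ hμ0
  obtain ⟨v, hv⟩ := hμ.exists_hasEigenvector
  have hv0 : v ≠ 0 := hv.2
  have hve : HA v + HB v = (μ : ℂ) • v := hv.apply_eq_smul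
  have hAB : (HA + HB).IsPositive := hHA.add hHB
  have hmem : ∀ w, w ∈ S ↔ HA w = 0 := by intro w; rw [hS]; rfl
  -- `v` is orthogonal to the common kernel
  have hvperp : ∀ w, HA w = 0 → HB w = 0 → inner ℂ w v = 0 := by
    intro w h1 h2
    have h3 := hAB.inner_left_eq_inner_right w v
    have h4 : (HA + HB) w = 0 := by simp [h1, h2]
    have h5 : (HA + HB) v = (μ : ℂ) • v := hve
    rw [h4, h5, inner_zero_left, inner_smul_right] at h3
    rcases mul_eq_zero.mp h3.symm with h | h
    · exact absurd (by exact_mod_cast h) hμ0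
    · exact h
  set s : S := S.orthogonalProjectionOnto v with hs
  set t : E := v - s with ht
  have htperp : ∀ w ∈ S, inner ℂ w t = 0 := by
    intro w hw
    have := S.inner_orthogonalProjectionOnto_eq_of_mem_left ⟨w, hw⟩ v
    rw [ht, inner_sub_right, sub_eq_zero]
    exact this.symm
  have hHAs : HA (s : E) = 0 := (hmem _).1 s.2
  -- gap for the compression
  have hcompsymm : (((S.orthogonalProjectionOnto).comp (HB.comp S.subtypeL)).toLinearMap).IsSymmetric := by
    intro x y
    have h1 := S.inner_orthogonalProjectionOnto_eq_of_mem_right y (HB x)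
    have h2 := S.inner_orthogonalProjectionOnto_eq_of_mem_left x (HB y)
    have h3 := hHB.inner_left_eq_inner_right (x : E) (y : E)
    exact h1.trans (h3.trans h2.symm)
  have hgB : c * ‖(s : E)‖ ^ 2 ≤ (inner ℂ (HB (s : E)) (s : E)).re := by
    have h := npl_gap _ hcompsymm c hcomp s (by
      intro w hw
      have hwz : S.orthogonalProjectionOnto (HB (w : E)) = 0 := hw
      have h1 := S.inner_orthogonalProjectionOnto_eq_of_mem_right w (HB (w : E))
      rw [hwz, inner_zero_left] at h1
      have h2 : HB (w : E) = 0 := npl_null HB hHB w (by rw [← h1]; simp)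
      rw [hs, S.inner_orthogonalProjectionOnto_eq_of_mem_left]
      exact hvperp _ ((hmem _).1 w.2) h2)
    have h1 := S.inner_orthogonalProjectionOnto_eq_of_mem_right s (HB (s : E))
    rw [← h1]
    exact h
  have hgA : d * ‖t‖ ^ 2 ≤ (inner ℂ (HA t) t).re :=
    npl_gap _ hHA.isSymmetric d hA t fun w hw => htperp w ((hmem w).2 hw)
  have hst : (s : E) + t = v := by rw [ht]; abel
  have hnorm : ‖v‖ ^ 2 = ‖(s : E)‖ ^ 2 + ‖t‖ ^ 2 := by
    have := norm_add_sq_eq_norm_sq_add_norm_sq_of_inner_eq_zero (𝕜 := ℂ) (s : E) t (htperp _ s.2)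
    rw [hst] at this
    nlinarith
  have hAv : (inner ℂ (HA v) v).re = (inner ℂ (HA t) t).re := by
    have h := npl_expand HA hHA 1 (s : E) t
    simp only [Complex.ofReal_one, one_smul, hst, hHAs, inner_zero_left, Complex.zero_re] at h
    linarith
  have htot : μ * ‖v‖ ^ 2 = (inner ℂ (HA t) t).re + (inner ℂ (HB v) v).re := by
    rw [← hAv, ← Complex.add_re, ← inner_add_left, hve, inner_smul_left, Complex.conj_ofReal,
      Complex.re_ofReal_mul]
    congr 1
    exact (inner_self_eq_norm_sq (𝕜 := ℂ) v).symm
  have hBt : (inner ℂ (HB t) t).re ≤ ‖HB‖ * ‖t‖ ^ 2 := by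
    calc (inner ℂ (HB t) t).re ≤ ‖inner ℂ (HB t) t‖ := Complex.re_le_norm _
      _ ≤ ‖HB t‖ * ‖t‖ := norm_inner_le_norm _ _
      _ ≤ (‖HB‖ * ‖t‖) * ‖t‖ := by gcongr; exact HB.le_opNorm t
      _ = ‖HB‖ * ‖t‖ ^ 2 := by ring
  have hb0 : 0 ≤ ‖HB‖ := norm_nonneg _
  set b := ‖HB‖
  -- the weighted parallelogram inequality
  set e : ℝ := (c + b) / d with he
  have hed : e * d = c + b := by rw [he]; field_simp
  have he0 : 0 < e := by positivity
  have hpos : 0 ≤ (inner ℂ (HB ((e : ℂ) • v + t)) ((e : ℂ) • v + t)).re :=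
    hHB.re_inner_nonneg_left _
  rw [npl_expand HB hHB] at hpos
  have hsq := npl_expand HB hHB (-1) v t
  have hneg : (((-1 : ℝ)) : ℂ) • v + t = -(s : E) := by rw [ht]; simp only [Complex.ofReal_neg, Complex.ofReal_one, neg_smul, one_smul]; abel
  rw [hneg, map_neg, inner_neg_neg] at hsq
  set qv := (inner ℂ (HB v) v).re
  set qt := (inner ℂ (HB t) t).re
  set qs := (inner ℂ (HB (s : E)) (s : E)).re
  set qa := (inner ℂ (HA t) t).re
  have hkey : e * qs ≤ e * (1 + e) * qv + (1 + e) * qt := by nlinarith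
  have hvpos : 0 < ‖v‖ ^ 2 := by positivity
  have hs0 := sq_nonneg ‖(s : E)‖
  have ht0 := sq_nonneg ‖t‖
  generalize ‖(s : E)‖ ^ 2 = σ at *
  generalize ‖t‖ ^ 2 = τ at *
  generalize ‖v‖ ^ 2 = ν at *
  -- multiply out
  have hcb : 0 < c + b := by positivity
  have hk2 : (c + b) * d * qs ≤ (c + b) * (c + d + b) * qv + d * (c + d + b) * qt := by
    have := mul_le_mul_of_nonneg_left hkey (sq_nonneg d)
    have e1 : d ^ 2 * (e * qs) = (c + b) * d * qs := by rw [← hed]; ring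
    have e2 : d ^ 2 * (e * (1 + e) * qv + (1 + e) * qt)
        = (c + b) * (c + d + b) * qv + d * (c + d + b) * qt := by
      rw [show c + d + b = e * d + d by linarith, ← hed]; ring
    linarith
  have hL : 0 < c + d + b := by positivity
  rw [div_le_iff₀ hL]
  have g1 : (c + b) * d * (c * σ) ≤ (c + b) * d * qs := by gcongr
  have g2 : d * (c + d + b) * qt ≤ d * (c + d + b) * (b * τ) := by gcongr
  have g3 : (c + b) * (c + d + b) * (d * τ) ≤ (c + b) * (c + d + b) * qa := by gcongr
  have g4 : 0 ≤ c * d * d * τ := by positivity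
  have hfin : (c + b) * (c * d * ν) ≤ (c + b) * (μ * (c + d + b) * ν) := by
    have : (c + b) * (μ * (c + d + b) * ν) = (c + b) * (c + d + b) * qa + (c + b) * (c + d + b) * qv := by
      linear_combination (c + b) * (c + d + b) * htot
    rw [this, hnorm]
    nlinarith
  exact le_of_mul_le_mul_right (le_of_mul_le_mul_left hfin hcb) hvpos
end

section
/- Let w, y > 0 and z ≥ 0 be real numbers, and let v be a complex number with |v|² ≤ wz. Then the smallest eigenvalue of the 2×2 Hermitian matrix [[w, conj(v)], [v, y+z]] equals (w + y + z − √((w + y + z)² + 4(|v|² − wy − wz)))/2, and this smallest eigenvalue is at least wy/(w + y + z). -/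
/-- Let `w, y > 0` and `z ≥ 0` be real numbers, and let `v` be a complex
number with `|v|² ≤ wz`.  Then the smallest eigenvalue of the 2×2 Hermitian matrix
`[[w, conj v], [v, y+z]]` equals
`(w + y + z − √((w + y + z)² + 4(|v|² − wy − wz)))/2`, and this smallest eigenvalue is at
least `wy/(w + y + z)`. -/
theorem two_by_two_smallest_eigenvalue
    (w y z : ℝ) (hw : 0 < w) (hy : 0 < y) (hz : 0 ≤ z)
    (v : ℂ) (hv : ‖v‖ ^ 2 ≤ w * z)
    (M : Matrix (Fin 2) (Fin 2) ℂ)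
    (hMdef : M = !![(w : ℂ), starRingEnd ℂ v; v, (y : ℂ) + (z : ℂ)])
    (hM : M.IsHermitian) :
    IsLeast (Set.range hM.eigenvalues)
        ((w + y + z - Real.sqrt ((w + y + z) ^ 2 +
            4 * (‖v‖ ^ 2 - w * y - w * z))) / 2)
      ∧ w * y / (w + y + z) ≤
          (w + y + z - Real.sqrt ((w + y + z) ^ 2 +
            4 * (‖v‖ ^ 2 - w * y - w * z))) / 2 := by
  have htr := hM.trace_eq_sum_eigenvalues
  have hdet := hM.det_eq_prod_eigenvalues
  have hvv : v * starRingEnd ℂ v = ((‖v‖ ^ 2 : ℝ) : ℂ) := by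
    rw [Complex.mul_conj, Complex.normSq_eq_norm_sq]
  have htr2 : w + y + z = hM.eigenvalues 0 + hM.eigenvalues 1 := by
    have h : M.trace = ((w + y + z : ℝ) : ℂ) := by
      rw [hMdef, Matrix.trace_fin_two]
      simp
      ring
    rw [h, Fin.sum_univ_two] at htr
    exact Complex.ofReal_injective (by rw [htr]; simp)
  have hdet2 : w * (y + z) - ‖v‖ ^ 2 = hM.eigenvalues 0 * hM.eigenvalues 1 := by
    have h : M.det = ((w * (y + z) - ‖v‖ ^ 2 : ℝ) : ℂ) := by
      rw [hMdef, Matrix.det_fin_two_of, mul_comm (starRingEnd ℂ v), hvv]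
      push_cast
      ring
    rw [h, Fin.prod_univ_two] at hdet
    exact Complex.ofReal_injective (by rw [hdet]; simp)
  constructor
  · generalize hM.eigenvalues = e at *
    have hs : Real.sqrt ((w + y + z) ^ 2 + 4 * (‖v‖ ^ 2 - w * y - w * z)) = |e 0 - e 1| := by
      rw [← Real.sqrt_sq_eq_abs]
      congr 1
      have : ‖v‖ ^ 2 = w * (y + z) - e 0 * e 1 := by linarith
      rw [this, htr2]
      have h3 : z = e 0 + e 1 - w - y := by linarith
      rw [h3]
      ring
    rw [hs, htr2]
    rcases le_total (e 0) (e 1) with h | h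
    · rw [abs_of_nonpos (by linarith)]
      refine ⟨⟨0, by ring⟩, ?_⟩
      rintro _ ⟨i, rfl⟩
      fin_cases i <;> simp <;> linarith
    · rw [abs_of_nonneg (by linarith)]
      refine ⟨⟨1, by ring⟩, ?_⟩
      rintro _ ⟨i, rfl⟩
      fin_cases i <;> simp <;> linarith
  · have hs : 0 < w + y + z := by linarith
    obtain ⟨t, ht⟩ : ∃ t, t = w * y / (w + y + z) := ⟨_, rfl⟩
    have hts : t * (w + y + z) = w * y := by rw [ht]; field_simp
    have hty : t ≤ y := by
      rw [ht, div_le_iff₀ hs]; nlinarith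
    have htw : t ≤ w := by
      rw [ht, div_le_iff₀ hs]; nlinarith
    rw [← ht]
    have : Real.sqrt ((w + y + z) ^ 2 + 4 * (‖v‖ ^ 2 - w * y - w * z)) ≤ w + y + z - 2 * t := by
      apply Real.sqrt_le_iff.mpr
      constructor
      · linarith
      · nlinarith [sq_nonneg t]
    linarith
end

section
/- Suppose the vertex set V is partitioned as V = V₁ ∪ ⋯ ∪ V_k and A(G) is block diagonal with respect to this partition with blocks A(G₁),…,A(G_k) (so G is the disjoint union of graphs G₁,…,G_k with vertex sets V₁,…,V_k), and suppose μ(G₁) = μ(G₂) = ⋯ = μ(G_k). Then for every N ≥ 1 the multiset of eigenvalues of H(G,N) equals the multiset of values Σ_{i∈[k] with N_i≠0} λ_{N_i}^{y_i}(G_i), where (N₁,…,N_k) ranges over all tuples of nonnegative integers with Σ_i N_i = N and, for each i with N_i ≠ 0, y_i ranges over {1,…,dim Z_{N_i}(G_i)}. -/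
namespace BH

variable {V : Type*} [Fintype V] [DecidableEq V]

/-- The operator `M` acting on the `w`-th factor of the `N`-fold tensor power
`(ℂ^V)^{⊗N}`, the latter identified with `ℂ^{V^N}`. -/
noncomputable def onFactor (N : ℕ) (M : Matrix V V ℂ) (w : Fin N) :
    Matrix (Fin N → V) (Fin N → V) ℂ :=
  Matrix.of fun x y =>
    (if ∀ u, u ≠ w → x u = y u then (1 : ℂ) else 0) * M (x w) (y w)

/-- The Bose–Hubbard interaction term
`Σ_{k ∈ V} Σ_{w ≠ w'} (|k⟩⟨k|)^{(w)} (|k⟩⟨k|)^{(w')}`, a diagonal matrix whose diagonal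
entry at a configuration `x : Fin N → V` counts the ordered pairs of distinct particles
sitting at a common vertex. -/
noncomputable def interaction (V : Type*) [DecidableEq V] (N : ℕ) :
    Matrix (Fin N → V) (Fin N → V) ℂ :=
  Matrix.of fun x y =>
    if x = y then
      (((Finset.univ : Finset (Fin N × Fin N)).filter
          fun p => p.1 ≠ p.2 ∧ x p.1 = x p.2).card : ℂ)
    else 0

/-- The `N`-particle Bose–Hubbard Hamiltonian `H_G^N` (with hopping and interaction
strengths equal to `1`) for the graph with adjacency matrix `A`. -/
noncomputable def bhHam (A : Matrix V V ℂ) (N : ℕ) :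
    Matrix (Fin N → V) (Fin N → V) ℂ :=
  (∑ w : Fin N, onFactor N A w) + interaction V N

/-- The bosonic (symmetric) subspace `Z_N(G)`: states invariant under every permutation
of the `N` tensor factors. -/
def symmStates (V : Type*) (N : ℕ) : Set ((Fin N → V) → ℂ) :=
  { ψ | ∀ σ : Equiv.Perm (Fin N), ∀ x : Fin N → V, ψ (x ∘ σ) = ψ x }

/-- The ground energy (smallest eigenvalue) of the compression of a Hermitian matrix `H`
to a subspace given as a set `Z` of states: the infimum of the Rayleigh quotients
`⟨ψ, H ψ⟩` over unit vectors `ψ ∈ Z`. -/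
noncomputable def groundEnergy {ι : Type*} [Fintype ι]
    (H : Matrix ι ι ℂ) (Z : Set (ι → ℂ)) : ℝ :=
  sInf { r : ℝ | ∃ ψ ∈ Z, dotProduct (star ψ) ψ = 1 ∧
    r = (dotProduct (star ψ) (H.mulVec ψ)).re }

/-- `μ(G)`: the smallest eigenvalue of the adjacency matrix `A = A(G)`. -/
noncomputable def mu (A : Matrix V V ℂ) : ℝ :=
  groundEnergy A Set.univ

/-- `λ_N^1(G)`: the smallest eigenvalue of `H(G,N)`, the restriction of
`H_G^N − N μ(G)·1` to the symmetric subspace `Z_N(G)`. -/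
noncomputable def lambda1 (A : Matrix V V ℂ) (N : ℕ) : ℝ :=
  groundEnergy (bhHam A N - ((N : ℂ) * (mu A : ℂ)) • 1) (symmStates V N)

end BH

namespace BH

/-- The bosonic (symmetric) subspace `Z_N(G)` as a submodule. -/
noncomputable def symmSubmodule (V : Type*) (N : ℕ) : Submodule ℂ ((Fin N → V) → ℂ) where
  carrier := symmStates V N
  add_mem' := by
    intro a b ha hb σ x
    have ha' := ha σ x
    have hb' := hb σ x
    simp only [Pi.add_apply]
    rw [ha', hb']
  zero_mem' := by intro σ x; rfl
  smul_mem' := by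
    intro c ψ hψ σ x
    have h := hψ σ x
    simp only [Pi.smul_apply]
    rw [h]

/-- The shifted Hamiltonian `H_G^N − N μ(G)·1` (whose restriction to the symmetric
subspace is `H(G,N)`). -/
noncomputable def shiftedHam {V : Type*} [Fintype V] [DecidableEq V]
    (A : Matrix V V ℂ) (N : ℕ) : Matrix (Fin N → V) (Fin N → V) ℂ :=
  bhHam A N - ((N : ℂ) * (mu A : ℂ)) • 1

/-- The multiset of eigenvalues (with multiplicity) of `H(G,N)`, i.e. the multiset of
roots of the characteristic polynomial of the restriction of `H_G^N − Nμ(G)·1` to the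
symmetric subspace `Z_N(G)` (the characteristic polynomial splits over `ℂ`). -/
noncomputable def bhSpectrum {V : Type*} [Fintype V] [DecidableEq V]
    (A : Matrix V V ℂ) (N : ℕ)
    (hinv : ∀ ψ ∈ symmSubmodule V N,
      (shiftedHam A N).mulVecLin ψ ∈ symmSubmodule V N) : Multiset ℂ :=
  (LinearMap.charpoly (((shiftedHam A N).mulVecLin).restrict hinv)).roots

/-- The multiset of all sums obtained by choosing one element from each multiset in the
list (with multiplicity). -/
noncomputable def sumChoices : List (Multiset ℂ) → Multiset ℂ
  | [] => {0}
  | m :: rest => m.bind fun a => (sumChoices rest).map fun b => a + b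

end BH

namespace BH

/-- `M` is similar to the diagonal matrix with diagonal `d`. -/
def DiagBy {ι : Type*} [Fintype ι] [DecidableEq ι] (M : Matrix ι ι ℂ) (d : ι → ℂ) : Prop :=
  ∃ P Q : Matrix ι ι ℂ, P * Q = 1 ∧ M * P = P * Matrix.diagonal d

lemma DiagBy.roots {ι : Type*} [Fintype ι] [DecidableEq ι] {M : Matrix ι ι ℂ} {d : ι → ℂ}
    (h : DiagBy M d) : M.charpoly.roots = ∑ j, ({d j} : Multiset ℂ) := by
  obtain ⟨P, Q, hPQ, hM⟩ := h
  have e : M = P * Matrix.diagonal d * Q := by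
    rw [← hM, Matrix.mul_assoc, hPQ, Matrix.mul_one]
  have hQP : Q * P = 1 := mul_eq_one_comm.mp hPQ
  rw [e, Matrix.charpoly_mul_comm, ← Matrix.mul_assoc, hQP, Matrix.one_mul,
    Matrix.charpoly_diagonal, Polynomial.roots_prod]
  · simp only [Polynomial.roots_X_sub_C]
    rfl
  · simp [Finset.prod_ne_zero_iff, Polynomial.X_sub_C_ne_zero]

lemma DiagBy.submatrix {ι κ : Type*} [Fintype ι] [DecidableEq ι] [Fintype κ] [DecidableEq κ]
    {M : Matrix ι ι ℂ} {d : ι → ℂ} (h : DiagBy M d) (e : κ ≃ ι) :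
    DiagBy (M.submatrix e e) (d ∘ e) := by
  obtain ⟨P, Q, hPQ, hM⟩ := h
  refine ⟨P.submatrix e e, Q.submatrix e e, ?_, ?_⟩
  · rw [Matrix.submatrix_mul_equiv, hPQ, Matrix.submatrix_one_equiv]
  · rw [Matrix.submatrix_mul_equiv, hM, ← Matrix.submatrix_diagonal_equiv d e,
      Matrix.submatrix_mul_equiv]

lemma DiagBy.blockDiagonal' {o : Type*} {m : o → Type*} [Fintype o] [DecidableEq o]
    [∀ i, Fintype (m i)] [∀ i, DecidableEq (m i)] {M : ∀ i, Matrix (m i) (m i) ℂ}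
    {d : ∀ i, m i → ℂ} (h : ∀ i, DiagBy (M i) (d i)) :
    DiagBy (Matrix.blockDiagonal' M) (fun ik => d ik.1 ik.2) := by
  choose P Q hPQ hM using h
  refine ⟨Matrix.blockDiagonal' P, Matrix.blockDiagonal' Q, ?_, ?_⟩
  · rw [← Matrix.blockDiagonal'_mul, ← Matrix.blockDiagonal'_one]
    congr 1; funext i; exact hPQ i
  · rw [← Matrix.blockDiagonal'_diagonal, ← Matrix.blockDiagonal'_mul,
      ← Matrix.blockDiagonal'_mul]
    congr 1; funext i; exact hM i

lemma sum_update_eq {ι : Type*} [Fintype ι] [DecidableEq ι] {S : ι → Type*} [∀ i, Fintype (S i)]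
    (x : ∀ i, S i) (w : ι) (g : (∀ i, S i) → ℂ) (p : (∀ i, S i) → Prop) [DecidablePred p]
    (hp : ∀ y, p y ↔ ∀ u, u ≠ w → x u = y u) :
    (∑ y, if p y then g y else 0) = ∑ c, g (Function.update x w c) := by
  symm
  refine Fintype.sum_of_injective (fun c => Function.update x w c)
    (Function.update_injective x w) _ _ ?_ ?_
  · intro y hy
    rw [if_neg]
    intro h
    apply hy
    refine ⟨y w, ?_⟩
    rw [hp] at h
    funext u
    by_cases hu : u = w
    · subst hu; simp
    · simp [hu, h u hu]
  · intro c
    rw [if_pos]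
    rw [hp]
    intro u hu
    simp [hu]

/-- Kronecker sum of a family of matrices. -/
noncomputable def kron {ι : Type*} [Fintype ι] [DecidableEq ι] {S : ι → Type*}
    [∀ i, DecidableEq (S i)] (M : ∀ i, Matrix (S i) (S i) ℂ) :
    Matrix (∀ i, S i) (∀ i, S i) ℂ :=
  Matrix.of fun x y => ∑ i, if ∀ j, j ≠ i → x j = y j then M i (x i) (y i) else 0

lemma DiagBy.kron {ι : Type*} [Fintype ι] [DecidableEq ι] {S : ι → Type*} [∀ i, Fintype (S i)]
    [∀ i, DecidableEq (S i)] {M : ∀ i, Matrix (S i) (S i) ℂ} {d : ∀ i, S i → ℂ}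
    (h : ∀ i, DiagBy (M i) (d i)) :
    DiagBy (BH.kron M) (fun y => ∑ i, d i (y i)) := by
  choose P Q hPQ hM using h
  refine ⟨Matrix.of fun x y => ∏ i, P i (x i) (y i), Matrix.of fun x y => ∏ i, Q i (x i) (y i),
    ?_, ?_⟩
  · ext x y
    simp only [Matrix.mul_apply, Matrix.of_apply, ← Finset.prod_mul_distrib]
    rw [← Fintype.prod_sum (fun i c => P i (x i) c * Q i c (y i))]
    simp only [← Matrix.mul_apply, hPQ, Matrix.one_apply]
    by_cases hxy : x = y
    · simp [hxy]
    · rw [if_neg hxy]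
      obtain ⟨i, hi⟩ := Function.ne_iff.mp hxy
      exact Finset.prod_eq_zero (Finset.mem_univ i) (if_neg hi)
  · ext x y
    rw [Matrix.mul_diagonal, Matrix.mul_apply]
    simp only [BH.kron, Matrix.of_apply, Finset.sum_mul, ite_mul, zero_mul]
    rw [Finset.sum_comm, Finset.mul_sum]
    refine Finset.sum_congr rfl fun i _ => ?_
    rw [sum_update_eq x i _ _ (fun y => Iff.rfl)]
    have key : ∀ c, M i (x i) (Function.update x i c i) *
        ∏ j, P j (Function.update x i c j) (y j)
        = (M i (x i) c * P i c (y i)) * ∏ j ∈ Finset.univ.erase i, P j (x j) (y j) := by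
      intro c
      rw [← Finset.mul_prod_erase _ _ (Finset.mem_univ i)]
      simp only [Function.update_self]
      rw [mul_assoc]
      congr 2
      refine Finset.prod_congr rfl fun j hj => ?_
      rw [Function.update_of_ne (Finset.ne_of_mem_erase hj)]
    rw [Finset.sum_congr rfl fun c _ => key c, ← Finset.sum_mul, ← Matrix.mul_apply, hM,
      Matrix.mul_diagonal, ← Finset.mul_prod_erase _ _ (Finset.mem_univ i)]
    ring

lemma herm_diag {ι : Type*} [Fintype ι] [DecidableEq ι] (B : Matrix ι ι ℂ) (hB : B.IsHermitian) :
    ∃ (U U' : Matrix ι ι ℂ) (d : ι → ℂ), U * U' = 1 ∧ B * U = U * Matrix.diagonal d := by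
  refine ⟨hB.eigenvectorUnitary, star (hB.eigenvectorUnitary : Matrix ι ι ℂ),
    RCLike.ofReal ∘ hB.eigenvalues, ?_, ?_⟩
  · simp
  · have h := hB.spectral_theorem
    rw [Unitary.conjStarAlgAut_apply] at h
    generalize hB.eigenvectorUnitary = U at h ⊢
    generalize Matrix.diagonal ((RCLike.ofReal : ℝ → ℂ) ∘ hB.eigenvalues) = d at h ⊢
    rw [h]
    rw [Matrix.mul_assoc]
    simp

/-- A matrix with real entries that is symmetric up to positive weights is diagonalizable. -/
lemma exists_diagBy {ι : Type*} [Fintype ι] [DecidableEq ι] (M : Matrix ι ι ℂ) (s : ι → ℝ)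
    (hs : ∀ i, 0 < s i) (hreal : ∀ i j, star (M i j) = M i j)
    (hsym : ∀ i j, (s i : ℂ) ^ 2 * M i j = (s j : ℂ) ^ 2 * M j i) :
    ∃ d, DiagBy M d := by
  have hs' : ∀ i, (s i : ℂ) ≠ 0 := fun i => by exact_mod_cast (hs i).ne'
  set D : Matrix ι ι ℂ := Matrix.diagonal fun i => (s i : ℂ)
  set E : Matrix ι ι ℂ := Matrix.diagonal fun i => (s i : ℂ)⁻¹
  have hED : E * D = 1 := by
    simp only [D, E, Matrix.diagonal_mul_diagonal]
    simp [hs']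
  have hDE : D * E = 1 := mul_eq_one_comm.mp hED
  have hB : (D * M * E).IsHermitian := by
    ext i j
    simp only [D, E, Matrix.conjTranspose_apply, Matrix.mul_diagonal, Matrix.diagonal_mul,
      star_mul', hreal]
    have := hsym i j
    have h1 := hs' i
    have h2 := hs' j
    simp only [RCLike.star_def, map_inv₀, Complex.conj_ofReal]
    field_simp
    linear_combination -this
  obtain ⟨U, U', d, hU, hd⟩ := herm_diag _ hB
  refine ⟨d, E * U, U' * D, ?_, ?_⟩
  · rw [Matrix.mul_assoc, ← Matrix.mul_assoc U, hU, Matrix.one_mul, hED]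
  · rw [Matrix.mul_assoc E, ← hd]
    simp only [← Matrix.mul_assoc, hED, Matrix.one_mul]

end BH
namespace BH

/-- Occupation numbers of `m` bosons on `W`. -/
abbrev Occ (W : Type*) [Fintype W] [DecidableEq W] (m : ℕ) : Type _ :=
  {n : W → ℕ // n ∈ Finset.piAntidiag (Finset.univ : Finset W) m}

lemma mem_occ {W : Type*} [Fintype W] [DecidableEq W] {m : ℕ} {n : W → ℕ} :
    n ∈ Finset.piAntidiag (Finset.univ : Finset W) m ↔ ∑ v, n v = m := by
  simp

/-- Matrix entries of the Hamiltonian in the occupation number representation. -/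
noncomputable def ell {W : Type*} [Fintype W] [DecidableEq W] (A : Matrix W W ℂ) (c : ℂ)
    (n n' : W → ℕ) : ℂ :=
  (∑ v, ∑ u, if n + Pi.single u 1 = n' + Pi.single v 1 then (n v : ℂ) * A v u else 0) +
    if n = n' then ∑ v, ((n v : ℂ) * ((n v : ℂ) - 1) - c * n v) else 0

/-- The Hamiltonian in the occupation number representation. -/
noncomputable def occHam {W : Type*} [Fintype W] [DecidableEq W] (A : Matrix W W ℂ) (c : ℂ)
    (m : ℕ) : Matrix (Occ W m) (Occ W m) ℂ :=
  Matrix.of fun n n' => ell A c n.1 n'.1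

/-- Weight of a configuration. -/
noncomputable def wt {W : Type*} [Fintype W] (n : W → ℕ) : ℝ :=
  (∏ v, ((n v).factorial : ℝ))⁻¹

lemma wt_pos {W : Type*} [Fintype W] (n : W → ℕ) : 0 < wt n := by
  unfold wt
  have : ∀ v, (0 : ℝ) < (n v).factorial := fun v => by exact_mod_cast Nat.factorial_pos _
  exact inv_pos.mpr (Finset.prod_pos fun v _ => this v)

lemma wt_add_single {W : Type*} [Fintype W] [DecidableEq W] (r : W → ℕ) (v : W) :
    wt (r + Pi.single v 1) * ((r v + 1 : ℕ) : ℝ) = wt r := by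
  unfold wt
  have h1 : ∏ x, (((r + Pi.single v 1 : W → ℕ) x).factorial : ℝ)
      = ((r v + 1 : ℕ) : ℝ) * ∏ x, ((r x).factorial : ℝ) := by
    rw [← Finset.mul_prod_erase _ _ (Finset.mem_univ v),
      ← Finset.mul_prod_erase _ (fun x => ((r x).factorial : ℝ)) (Finset.mem_univ v), ← mul_assoc]
    congr 1
    · simp [Nat.factorial_succ]
    · refine Finset.prod_congr rfl fun j hj => ?_
      simp [Finset.ne_of_mem_erase hj]
  rw [h1, mul_inv, mul_comm, ← mul_assoc, mul_inv_cancel₀, one_mul]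
  positivity

lemma wt_hop {W : Type*} [Fintype W] [DecidableEq W] {n n' : W → ℕ} {u v : W}
    (h : n + Pi.single u 1 = n' + Pi.single v 1) :
    wt n * (n v : ℝ) = wt n' * (n' u : ℝ) := by
  by_cases huv : u = v
  · subst huv
    rw [add_right_cancel h]
  have hv := congrFun h v
  have hu := congrFun h u
  simp [huv, Ne.symm huv] at hv hu
  set r : W → ℕ := n - Pi.single v 1 with hr
  have h1 : n = r + Pi.single v 1 := by
    funext x
    by_cases hx : x = v
    · subst hx; simp [hr]; omega
    · simp [hr, hx]
  have h2 : n' = r + Pi.single u 1 := by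
    funext x
    have := congrFun h x
    by_cases hx : x = v
    · subst hx; simp [hr, Ne.symm huv] at *; omega
    · by_cases hx' : x = u
      · subst hx'; simp [hr, huv] at *; omega
      · simp [hr, hx, hx'] at *; omega
  have e1 := wt_add_single r v
  have e2 := wt_add_single r u
  rw [← h1] at e1
  rw [← h2] at e2
  have f1 : n v = r v + 1 := by rw [h1]; simp
  have f2 : n' u = r u + 1 := by rw [h2]; simp
  rw [f1, f2, e1, e2]

lemma exists_diagBy_occHam {W : Type*} [Fintype W] [DecidableEq W] (A : Matrix W W ℂ)
    (hsymm : A.IsSymm) (h01 : ∀ i j, A i j = 0 ∨ A i j = 1) (c : ℝ) (m : ℕ) :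
    ∃ d, DiagBy (occHam A (c : ℂ) m) d := by
  refine exists_diagBy _ (fun n => Real.sqrt (wt n.1)) (fun n => Real.sqrt_pos.mpr (wt_pos _))
    ?_ ?_
  · intro n n'
    have hA : ∀ i j, (starRingEnd ℂ) (A i j) = A i j := by
      intro i j
      rcases h01 i j with h | h <;> simp [h]
    simp [occHam, ell, apply_ite (starRingEnd ℂ), hA]
  · intro n n'
    have hsq : ∀ n : W → ℕ, ((Real.sqrt (wt n) : ℝ) : ℂ) ^ 2 = (wt n : ℂ) := by
      intro n
      rw [← Complex.ofReal_pow, Real.sq_sqrt (wt_pos n).le]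
    rw [hsq, hsq]
    simp only [occHam, Matrix.of_apply, ell, mul_add]
    congr 1
    · rw [Finset.sum_comm, Finset.mul_sum, Finset.mul_sum]
      refine Finset.sum_congr rfl fun u _ => ?_
      rw [Finset.mul_sum, Finset.mul_sum]
      refine Finset.sum_congr rfl fun v _ => ?_
      by_cases h : n.1 + Pi.single u 1 = n'.1 + Pi.single v 1
      · rw [if_pos h, if_pos h.symm, hsymm.apply, ← mul_assoc, ← mul_assoc]
        congr 1
        exact_mod_cast wt_hop h
      · rw [if_neg h, if_neg (Ne.symm h)]
        simp
    · by_cases h : n.1 = n'.1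
      · rw [if_pos h, if_pos h.symm, h]
      · rw [if_neg h, if_neg (Ne.symm h)]
        simp

/-- Occupation numbers of a configuration. -/
def occ {W : Type*} [DecidableEq W] {m : ℕ} (x : Fin m → W) (v : W) : ℕ :=
  (Finset.univ.filter fun w => x w = v).card

lemma occ_eq_sum {W : Type*} [DecidableEq W] {m : ℕ} (x : Fin m → W) (v : W) :
    occ x v = ∑ w, if x w = v then 1 else 0 := by
  simp [occ]

lemma sum_occ {W : Type*} [Fintype W] [DecidableEq W] {m : ℕ} (x : Fin m → W) :
    ∑ v, occ x v = m := by
  simp only [occ_eq_sum]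
  rw [Finset.sum_comm]
  simp

lemma sum_occ_mul {W : Type*} [Fintype W] [DecidableEq W] {m : ℕ} (x : Fin m → W) (g : W → ℂ) :
    ∑ v, (occ x v : ℂ) * g v = ∑ w, g (x w) := by
  simp only [occ_eq_sum]
  push_cast
  simp only [Finset.sum_mul]
  rw [Finset.sum_comm]
  simp

lemma occ_update {W : Type*} [DecidableEq W] {m : ℕ} (x : Fin m → W) (w : Fin m)
    (u : W) : occ x + Pi.single u 1 = occ (Function.update x w u) + Pi.single (x w) 1 := by
  funext v
  simp only [Pi.add_apply, occ_eq_sum]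
  rw [← Finset.add_sum_erase _ _ (Finset.mem_univ w),
    ← Finset.add_sum_erase _ (fun w' => if Function.update x w u w' = v then 1 else 0)
      (Finset.mem_univ w)]
  have : ∑ x_1 ∈ Finset.univ.erase w, (if Function.update x w u x_1 = v then 1 else 0)
      = ∑ x_1 ∈ Finset.univ.erase w, if x x_1 = v then 1 else 0 := by
    refine Finset.sum_congr rfl fun j hj => ?_
    rw [Function.update_of_ne (Finset.ne_of_mem_erase hj)]
  rw [this]
  simp only [Function.update_self, Pi.single_apply, eq_comm (a := v)]
  omega

lemma occ_comp {W : Type*} [DecidableEq W] {m : ℕ} (x : Fin m → W) (σ : Equiv.Perm (Fin m)) :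
    occ (x ∘ σ) = occ x := by
  funext v
  rw [occ_eq_sum, occ_eq_sum]
  exact Equiv.sum_comp σ (fun w => if x w = v then 1 else 0)

lemma exists_perm {W : Type*} [DecidableEq W] {m : ℕ} {x y : Fin m → W} (h : occ x = occ y) :
    ∃ σ : Equiv.Perm (Fin m), y ∘ σ = x := by
  have e : ∀ c, Nonempty ({a // x a = c} ≃ {b // y b = c}) := by
    intro c
    have := congrFun h c
    simp only [occ] at this
    refine ⟨Fintype.equivOfCardEq ?_⟩
    rw [Fintype.card_subtype, Fintype.card_subtype, this]
  refine ⟨Equiv.ofFiberEquiv fun c => (e c).some, ?_⟩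
  funext a
  exact Equiv.ofFiberEquiv_map _ a

lemma exists_occ {W : Type*} [Fintype W] [DecidableEq W] {m : ℕ} (n : W → ℕ)
    (hn : ∑ v, n v = m) : ∃ x : Fin m → W, occ x = n := by
  have hc : Fintype.card (Σ v : W, Fin (n v)) = Fintype.card (Fin m) := by simp [hn]
  let e := Fintype.equivOfCardEq hc
  refine ⟨fun w => (e.symm w).1, ?_⟩
  funext v
  rw [occ_eq_sum, Equiv.sum_comp e.symm (fun w => if w.1 = v then 1 else 0), Fintype.sum_sigma]
  rw [Finset.sum_eq_single v]
  · simp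
  · intro b _ hb
    simp [hb]
  · simp

lemma card_pairs {W : Type*} [Fintype W] [DecidableEq W] {m : ℕ} (x : Fin m → W) :
    (((Finset.univ : Finset (Fin m × Fin m)).filter
          fun p => p.1 ≠ p.2 ∧ x p.1 = x p.2).card : ℂ)
      = ∑ v, (occ x v : ℂ) * ((occ x v : ℂ) - 1) := by
  rw [sum_occ_mul x (fun v => (occ x v : ℂ) - 1), Finset.card_filter]
  push_cast
  rw [Fintype.sum_prod_type]
  refine Finset.sum_congr rfl fun w _ => ?_
  rw [occ_eq_sum]
  push_cast
  rw [← Finset.add_sum_erase _ _ (Finset.mem_univ w),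
    ← Finset.add_sum_erase _ (fun w' => if x w' = x w then (1 : ℂ) else 0) (Finset.mem_univ w)]
  simp only [ne_eq, not_true_eq_false, false_and, if_false, if_true, zero_add,
    add_sub_cancel_left]
  refine Finset.sum_congr rfl fun j hj => ?_
  have := Finset.ne_of_mem_erase hj
  simp [Ne.symm this, eq_comm]

/-- Symmetric functions are functions of the occupation numbers. -/
noncomputable def pull (W : Type*) [Fintype W] [DecidableEq W] (m : ℕ) :
    (Occ W m → ℂ) →ₗ[ℂ] symmSubmodule W m where
  toFun f := ⟨fun x => f ⟨occ x, mem_occ.mpr (sum_occ x)⟩, by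
    intro σ x
    simp only [occ_comp]⟩
  map_add' f g := rfl
  map_smul' c f := rfl

lemma pull_apply {W : Type*} [Fintype W] [DecidableEq W] {m : ℕ} (f : Occ W m → ℂ)
    (x : Fin m → W) : (pull W m f).1 x = f ⟨occ x, mem_occ.mpr (sum_occ x)⟩ := rfl

lemma pull_bijective (W : Type*) [Fintype W] [DecidableEq W] (m : ℕ) :
    Function.Bijective (pull W m) := by
  constructor
  · intro f g h
    funext n
    obtain ⟨x, hx⟩ := exists_occ n.1 (mem_occ.mp n.2)
    have := congrFun (congrArg Subtype.val h) x
    rw [pull_apply, pull_apply] at this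
    have e : (⟨occ x, mem_occ.mpr (sum_occ x)⟩ : Occ W m) = n := Subtype.ext hx
    rwa [e] at this
  · intro ψ
    choose X hX using fun n : Occ W m => exists_occ n.1 (mem_occ.mp n.2)
    refine ⟨fun n => ψ.1 (X n), ?_⟩
    apply Subtype.ext
    funext x
    rw [pull_apply]
    obtain ⟨σ, hσ⟩ := exists_perm (hX ⟨occ x, mem_occ.mpr (sum_occ x)⟩)
    rw [← hσ]
    exact ψ.2 σ x

lemma hop_sum {W : Type*} [Fintype W] [DecidableEq W] {m : ℕ} (x : Fin m → W)
    (A : Matrix W W ℂ) (n' : W → ℕ) :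
    (∑ v, ∑ u, if occ x + Pi.single u 1 = n' + Pi.single v 1 then
      (occ x v : ℂ) * A v u else 0) = ∑ w, ∑ u,
        if occ x + Pi.single u 1 = n' + Pi.single (x w) 1 then A (x w) u else 0 := by
  have h := sum_occ_mul x (fun v => ∑ u,
        if occ x + Pi.single u 1 = n' + Pi.single v 1 then A v u else 0)
  simp only [Finset.mul_sum, mul_ite, mul_zero] at h
  exact h

lemma shiftedHam_pull {W : Type*} [Fintype W] [DecidableEq W] (A : Matrix W W ℂ) (m : ℕ)
    (f : Occ W m → ℂ) (x : Fin m → W) :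
    (shiftedHam A m).mulVec (pull W m f).1 x
      = (occHam A (mu A : ℂ) m).mulVec f ⟨occ x, mem_occ.mpr (sum_occ x)⟩ := by
  set ψ := (pull W m f).1 with hψ
  have hop : ∀ w, (onFactor m A w).mulVec ψ x = ∑ u, A (x w) u * ψ (Function.update x w u) := by
    intro w
    simp only [Matrix.mulVec, dotProduct, onFactor, Matrix.of_apply, ite_mul, one_mul, zero_mul]
    rw [sum_update_eq x w (fun y => A (x w) (y w) * ψ y) _ (fun y => Iff.rfl)]
    simp
  have inter : (interaction W m).mulVec ψ x = (∑ v, (occ x v : ℂ) * ((occ x v : ℂ) - 1)) * ψ x := by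
    simp only [Matrix.mulVec, dotProduct, interaction, Matrix.of_apply, ite_mul, zero_mul]
    rw [Finset.sum_ite_eq, if_pos (Finset.mem_univ _), card_pairs]
  have lhs : (shiftedHam A m).mulVec ψ x = (∑ w, ∑ u, A (x w) u * ψ (Function.update x w u))
      + (∑ v, (occ x v : ℂ) * ((occ x v : ℂ) - 1)) * ψ x - (m : ℂ) * (mu A : ℂ) * ψ x := by
    simp only [shiftedHam, bhHam, Matrix.sub_mulVec, Matrix.add_mulVec, Matrix.sum_mulVec,
      Matrix.smul_mulVec, Matrix.one_mulVec, Pi.sub_apply, Pi.add_apply, Finset.sum_apply,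
      Pi.smul_apply, smul_eq_mul, hop, inter]
  rw [lhs]
  set n0 : Occ W m := ⟨occ x, mem_occ.mpr (sum_occ x)⟩ with hn0
  have rhs1 : ∑ n' : Occ W m, (∑ v, ∑ u, if occ x + Pi.single u 1 = n'.1 + Pi.single v 1 then
      (occ x v : ℂ) * A v u else 0) * f n'
      = ∑ w, ∑ u, A (x w) u * ψ (Function.update x w u) := by
    simp only [hop_sum, Finset.sum_mul]
    rw [Finset.sum_comm]
    refine Finset.sum_congr rfl fun w _ => ?_
    rw [Finset.sum_comm]
    refine Finset.sum_congr rfl fun u _ => ?_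
    have e2 : ∀ n' : Occ W m, (occ x + Pi.single u 1 = n'.1 + Pi.single (x w) 1) ↔
        (⟨occ (Function.update x w u), mem_occ.mpr (sum_occ _)⟩ : Occ W m) = n' := by
      intro n'
      rw [occ_update x w u, add_left_inj]
      exact ⟨fun h => Subtype.ext h, fun h => congrArg Subtype.val h⟩
    simp only [e2, ite_mul, zero_mul]
    rw [Finset.sum_ite_eq, if_pos (Finset.mem_univ _)]
    rfl
  have rhs2 : ∑ n' : Occ W m, (if occ x = n'.1 then
      ∑ v, ((occ x v : ℂ) * ((occ x v : ℂ) - 1) - (mu A : ℂ) * occ x v) else 0) * f n'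
      = (∑ v, (occ x v : ℂ) * ((occ x v : ℂ) - 1)) * ψ x - (m : ℂ) * (mu A : ℂ) * ψ x := by
    have e2 : ∀ n' : Occ W m, (occ x = n'.1) ↔ n0 = n' := by
      intro n'
      exact ⟨fun h => Subtype.ext h, fun h => congrArg Subtype.val h⟩
    simp only [e2, ite_mul, zero_mul]
    rw [Finset.sum_ite_eq, if_pos (Finset.mem_univ _), Finset.sum_sub_distrib, ← Finset.mul_sum]
    have : ∑ v, (occ x v : ℂ) = m := by exact_mod_cast sum_occ x
    rw [this, hψ, pull_apply]
    ring
  simp only [Matrix.mulVec, dotProduct, occHam, Matrix.of_apply, ell, add_mul,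
    Finset.sum_add_distrib]
  rw [hn0] at *
  rw [rhs1, rhs2]
  ring

lemma bhSpectrum_eq {W : Type*} [Fintype W] [DecidableEq W] (A : Matrix W W ℂ) (m : ℕ)
    (hinv : ∀ ψ ∈ symmSubmodule W m, (shiftedHam A m).mulVecLin ψ ∈ symmSubmodule W m) :
    bhSpectrum A m hinv = (occHam A (mu A : ℂ) m).charpoly.roots := by
  unfold bhSpectrum
  congr 1
  let e := LinearEquiv.ofBijective (pull W m) (pull_bijective W m)
  rw [← Matrix.charpoly_mulVecLin, ← LinearEquiv.charpoly_conj e]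
  congr 1
  apply LinearMap.ext
  intro ψ
  obtain ⟨f, rfl⟩ := e.surjective ψ
  rw [LinearEquiv.conj_apply_apply, LinearEquiv.symm_apply_apply]
  apply Subtype.ext
  funext x
  exact shiftedHam_pull A m f x

end BH
namespace BH

lemma sumChoices_filter {α : Type*} (l : List α) (p : α → Bool) (f : α → Multiset ℂ)
    (h : ∀ i, p i = false → f i = {0}) :
    sumChoices ((l.filter p).map f) = sumChoices (l.map f) := by
  induction l with
  | nil => rfl
  | cons a l ih =>
    by_cases hp : p a = true
    · rw [List.filter_cons_of_pos hp, List.map_cons, List.map_cons, sumChoices, sumChoices, ih]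
    · rw [List.filter_cons_of_neg hp, List.map_cons, sumChoices, ih, h a (by simpa using hp)]
      simp

lemma sum_bind_singleton {α : Type*} [Fintype α] (d : α → ℂ) (g : ℂ → Multiset ℂ) :
    (∑ j, ({d j} : Multiset ℂ)).bind g = ∑ j, g (d j) := by
  classical
  have : ∀ s : Finset α, (∑ j ∈ s, ({d j} : Multiset ℂ)).bind g = ∑ j ∈ s, g (d j) := by
    intro s
    induction s using Finset.induction_on with
    | empty => simp
    | insert a s ha ih => rw [Finset.sum_insert ha, Finset.sum_insert ha, Multiset.add_bind, ih,
        Multiset.singleton_bind]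
  exact this _

lemma sumChoices_pi (k : ℕ) (S : Fin k → Type*) [∀ i, Fintype (S i)] (d : ∀ i, S i → ℂ) :
    sumChoices ((List.finRange k).map fun i => ∑ j : S i, ({d i j} : Multiset ℂ))
      = ∑ y : ∀ i, S i, ({∑ i, d i (y i)} : Multiset ℂ) := by
  induction k with
  | zero => simp [sumChoices]
  | succ k ih =>
    rw [List.finRange_succ, List.map_cons, sumChoices, List.map_map]
    have ih' := ih (fun i => S i.succ) (fun i => d i.succ)
    rw [sum_bind_singleton, ← Equiv.sum_comp (Fin.consEquiv S), Fintype.sum_prod_type]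
    refine Finset.sum_congr rfl fun a _ => ?_
    have e : ((fun i => ∑ j : S i, ({d i j} : Multiset ℂ)) ∘ Fin.succ)
        = fun i : Fin k => ∑ j : S i.succ, ({d i.succ j} : Multiset ℂ) := rfl
    rw [e, ih', ← Multiset.coe_mapAddMonoidHom, map_sum]
    refine Finset.sum_congr rfl fun y _ => ?_
    simp [Fin.sum_univ_succ, Fin.consEquiv]

lemma occHam_zero_roots {W : Type*} [Fintype W] [DecidableEq W] (A : Matrix W W ℂ) (c : ℂ) :
    (occHam A c 0).charpoly.roots = {0} := by
  have h0 : ∀ n : Occ W 0, n.1 = 0 := by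
    intro n
    have := mem_occ.mp n.2
    funext v
    exact (Finset.sum_eq_zero_iff.mp this) v (Finset.mem_univ v)
  have hM : occHam A c 0 = 0 := by
    ext n n'
    simp [occHam, ell, h0]
  have hcard : Fintype.card (Occ W 0) = 1 := by
    rw [Fintype.card_eq_one_iff]
    exact ⟨⟨0, by simp⟩, fun n => Subtype.ext (h0 n)⟩
  rw [hM, Matrix.charpoly_zero, hcard]
  simp

section decomp

variable {V : Type*} [Fintype V] [DecidableEq V] {k : ℕ} (comp : V → Fin k)

/-- Restriction of occupation numbers to a component. -/
def res (n : V → ℕ) (i : Fin k) (v : {v : V // comp v = i}) : ℕ := n v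

lemma hop_iff (n n' : V → ℕ) (i : Fin k) (u v : {v : V // comp v = i}) :
    n + Pi.single (u : V) 1 = n' + Pi.single (v : V) 1 ↔
      (∀ j, j ≠ i → res comp n j = res comp n' j) ∧
        res comp n i + Pi.single u 1 = res comp n' i + Pi.single v 1 := by
  constructor
  · intro h
    refine ⟨?_, ?_⟩
    · intro j hj
      funext x
      have hx := congrFun h x
      have h1 : (x : V) ≠ u := fun e => hj (by rw [← x.2, e, u.2])
      have h2 : (x : V) ≠ v := fun e => hj (by rw [← x.2, e, v.2])
      simpa [h1, h2, res] using hx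
    · funext x
      have hx := congrFun h x
      simpa [Pi.single_apply, res, Subtype.ext_iff] using hx
  · rintro ⟨h1, h2⟩
    funext x
    by_cases hx : comp x = i
    · have := congrFun h2 ⟨x, hx⟩
      simpa [Pi.single_apply, res, Subtype.ext_iff] using this
    · have := congrFun (h1 _ hx) ⟨x, rfl⟩
      have h1 : x ≠ u := fun e => hx (by rw [e, u.2])
      have h2 : x ≠ v := fun e => hx (by rw [e, v.2])
      simpa [h1, h2, res] using this

lemma eq_iff_res {V : Type*} {k : ℕ} (comp : V → Fin k) (n n' : V → ℕ) (i : Fin k) :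
    n = n' ↔ (∀ j, j ≠ i → res comp n j = res comp n' j) ∧ res comp n i = res comp n' i := by
  constructor
  · rintro rfl
    simp
  · rintro ⟨h1, h2⟩
    funext x
    by_cases hx : comp x = i
    · exact congrFun h2 ⟨x, hx⟩
    · exact congrFun (h1 _ hx) ⟨x, rfl⟩

lemma ell_decomp (A : Matrix V V ℂ) (hblock : ∀ i j, comp i ≠ comp j → A i j = 0) (c : ℂ)
    (n n' : V → ℕ) :
    ell A c n n' = ∑ i, if ∀ j, j ≠ i → res comp n j = res comp n' j then
      ell (A.submatrix (fun v : {v : V // comp v = i} => (v : V))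
        (fun v : {v : V // comp v = i} => (v : V))) c (res comp n i) (res comp n' i) else 0 := by
  have h1 : (∑ v, ∑ u, if n + Pi.single u 1 = n' + Pi.single v 1 then (n v : ℂ) * A v u else 0)
      = ∑ i : Fin k, ∑ v : {v : V // comp v = i}, ∑ u : {v : V // comp v = i},
        if n + Pi.single (u : V) 1 = n' + Pi.single (v : V) 1 then (n v : ℂ) * A v u else 0 := by
    rw [← Fintype.sum_fiberwise comp]
    refine Finset.sum_congr rfl fun i _ => Finset.sum_congr rfl fun v _ => ?_
    symm
    refine Fintype.sum_of_injective (fun u : {v : V // comp v = i} => (u : V))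
      Subtype.val_injective _ _ ?_ ?_
    · intro u hu
      have : comp v ≠ comp u := by
        intro e
        exact hu ⟨⟨u, by rw [← e, v.2]⟩, rfl⟩
      simp [hblock _ _ this]
    · intro u
      rfl
  have h2 : (if n = n' then ∑ v, ((n v : ℂ) * ((n v : ℂ) - 1) - c * n v) else 0)
      = ∑ i : Fin k, if n = n' then
        ∑ v : {v : V // comp v = i}, ((n v : ℂ) * ((n v : ℂ) - 1) - c * n v) else 0 := by
    by_cases h : n = n'
    · simp only [if_pos h]
      rw [← Fintype.sum_fiberwise comp]
    · simp [if_neg h]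
  unfold ell
  rw [h1, h2, ← Finset.sum_add_distrib]
  refine Finset.sum_congr rfl fun i _ => ?_
  simp only [hop_iff comp n n' i, eq_iff_res comp n n' i]
  by_cases h : ∀ j, j ≠ i → res comp n j = res comp n' j
  · have ht : (∀ j, j ≠ i → res comp n j = res comp n' j) ↔ True := iff_true_intro h
    simp only [ht, true_and, if_true]
    rfl
  · simp [h]

/-- Glue occupation numbers on components. -/
def glue (N : ℕ) (a : Σ ν : {ν // ν ∈ Finset.Nat.antidiagonalTuple k N},
    ∀ i, Occ {v : V // comp v = i} (ν.1 i)) : Occ V N :=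
  ⟨fun v => (a.2 (comp v)).1 ⟨v, rfl⟩, by
    rw [mem_occ, ← Fintype.sum_fiberwise comp]
    refine Eq.trans ?_ (Finset.Nat.mem_antidiagonalTuple.mp a.1.2)
    refine Finset.sum_congr rfl fun i _ => ?_
    rw [← mem_occ.mp (a.2 i).2]
    refine Finset.sum_congr rfl fun v _ => ?_
    obtain ⟨v, rfl⟩ := v
    rfl⟩

lemma res_glue (N : ℕ) (a : Σ ν : {ν // ν ∈ Finset.Nat.antidiagonalTuple k N},
    ∀ i, Occ {v : V // comp v = i} (ν.1 i)) (i : Fin k) :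
    res comp (glue comp N a).1 i = (a.2 i).1 := by
  funext v
  obtain ⟨v, rfl⟩ := v
  rfl

lemma glue_bijective (N : ℕ) : Function.Bijective (glue comp N) := by
  constructor
  · intro a b h
    have hr : ∀ i, (a.2 i).1 = (b.2 i).1 := by
      intro i
      rw [← res_glue, ← res_glue, h]
    obtain ⟨ν, z⟩ := a
    obtain ⟨ν', z'⟩ := b
    have hν : ν = ν' := by
      apply Subtype.ext
      funext i
      rw [← mem_occ.mp (z i).2, ← mem_occ.mp (z' i).2]
      have := hr i
      simp only at this
      rw [this]
    subst hν
    congr 1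
    funext i
    exact Subtype.ext (hr i)
  · intro n
    refine ⟨⟨⟨fun i => ∑ v, res comp n.1 i v, ?_⟩, fun i => ⟨res comp n.1 i, ?_⟩⟩, ?_⟩
    · rw [Finset.Nat.mem_antidiagonalTuple]
      refine Eq.trans ?_ (mem_occ.mp n.2)
      rw [← Fintype.sum_fiberwise comp]
      rfl
    · rw [mem_occ]
    · rfl

lemma occHam_glue (A : Matrix V V ℂ) (hblock : ∀ i j, comp i ≠ comp j → A i j = 0) (c : ℂ)
    (N : ℕ) :
    (occHam A c N).submatrix (glue comp N) (glue comp N)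
      = Matrix.blockDiagonal' (fun ν : {ν // ν ∈ Finset.Nat.antidiagonalTuple k N} =>
        kron fun i => occHam (A.submatrix (fun v : {v : V // comp v = i} => (v : V))
          (fun v : {v : V // comp v = i} => (v : V))) c (ν.1 i)) := by
  ext a b
  rw [Matrix.submatrix_apply, occHam, Matrix.of_apply, ell_decomp comp A hblock]
  simp only [res_glue]
  obtain ⟨ν, z⟩ := a
  obtain ⟨ν', z'⟩ := b
  by_cases hν : ν = ν'
  · subst hν
    rw [Matrix.blockDiagonal'_apply_eq]
    simp only [kron, occHam, Matrix.of_apply, Subtype.ext_iff]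
  · rw [Matrix.blockDiagonal'_apply_ne _ _ _ hν]
    refine Finset.sum_eq_zero fun i _ => ?_
    rw [if_neg]
    intro h
    apply hν
    have h1 : ∀ j, j ≠ i → ν.1 j = ν'.1 j := by
      intro j hj
      rw [← mem_occ.mp (z j).2, ← mem_occ.mp (z' j).2]
      have := h j hj
      simp only at this
      rw [this]
    have e1 := Finset.Nat.mem_antidiagonalTuple.mp ν.2
    have e2 := Finset.Nat.mem_antidiagonalTuple.mp ν'.2
    rw [← Finset.add_sum_erase _ _ (Finset.mem_univ i)] at e1 e2
    have e3 : ∑ j ∈ Finset.univ.erase i, ν.1 j = ∑ j ∈ Finset.univ.erase i, ν'.1 j :=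
      Finset.sum_congr rfl fun j hj => h1 j (Finset.ne_of_mem_erase hj)
    apply Subtype.ext
    funext j
    by_cases hj : j = i
    · subst hj
      omega
    · exact h1 j hj

end decomp

end BH

namespace BH

lemma occHam_diag {V : Type*} [Fintype V] [DecidableEq V] {k : ℕ} (comp : V → Fin k)
    (A : Matrix V V ℂ) (hblock : ∀ i j, comp i ≠ comp j → A i j = 0) (c : ℂ) (N : ℕ)
    (d : ∀ (i : Fin k) (m : ℕ), Occ {v : V // comp v = i} m → ℂ)
    (hd : ∀ i m, DiagBy (occHam (A.submatrix (fun v : {v : V // comp v = i} => (v : V))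
        (fun v : {v : V // comp v = i} => (v : V))) c m) (d i m)) :
    DiagBy ((occHam A c N).submatrix (glue comp N) (glue comp N))
      (fun a => ∑ i, d i (a.1.1 i) (a.2 i)) := by
  rw [occHam_glue comp A hblock]
  have hk : ∀ ν : {ν // ν ∈ Finset.Nat.antidiagonalTuple k N},
      DiagBy (kron fun i => occHam (A.submatrix (fun v : {v : V // comp v = i} => (v : V))
        (fun v : {v : V // comp v = i} => (v : V))) c (ν.1 i))
        (fun y => ∑ i, d i (ν.1 i) (y i)) := fun ν =>
    DiagBy.kron (d := fun i => d i (ν.1 i)) fun i => hd i (ν.1 i)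
  exact DiagBy.blockDiagonal' (d := fun (ν : {ν // ν ∈ Finset.Nat.antidiagonalTuple k N})
    (y : ∀ i, Occ {v : V // comp v = i} (ν.1 i)) => ∑ i, d i (ν.1 i) (y i)) hk

lemma charpoly_submatrix_bij {ι κ : Type*} [Fintype ι] [DecidableEq ι] [Fintype κ] [DecidableEq κ]
    (M : Matrix ι ι ℂ) (g : κ → ι) (hg : Function.Bijective g) :
    (M.submatrix g g).charpoly = M.charpoly := by
  have h := Matrix.charpoly_reindex (Equiv.ofBijective g hg).symm M
  rw [Matrix.reindex_apply] at h
  simpa using h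

lemma occHam_glue_charpoly {V : Type*} [Fintype V] [DecidableEq V] {k : ℕ} (comp : V → Fin k)
    (A : Matrix V V ℂ) (c : ℂ) (N : ℕ) :
    ((occHam A c N).submatrix (glue comp N) (glue comp N)).charpoly
      = (occHam A c N).charpoly :=
  charpoly_submatrix_bij _ _ (glue_bijective comp N)

lemma occHam_roots {V : Type*} [Fintype V] [DecidableEq V] {k : ℕ} (comp : V → Fin k)
    (A : Matrix V V ℂ) (hblock : ∀ i j, comp i ≠ comp j → A i j = 0) (c : ℂ) (N : ℕ)
    (d : ∀ (i : Fin k) (m : ℕ), Occ {v : V // comp v = i} m → ℂ)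
    (hd : ∀ i m, DiagBy (occHam (A.submatrix (fun v : {v : V // comp v = i} => (v : V))
        (fun v : {v : V // comp v = i} => (v : V))) c m) (d i m)) :
    (occHam A c N).charpoly.roots = ∑ ν ∈ Finset.Nat.antidiagonalTuple k N,
      ∑ y : ∀ i, Occ {v : V // comp v = i} (ν i), ({∑ i, d i (ν i) (y i)} : Multiset ℂ) := by
  rw [← occHam_glue_charpoly comp, (occHam_diag comp A hblock c N d hd).roots, Fintype.sum_sigma]
  exact Finset.sum_coe_sort (Finset.Nat.antidiagonalTuple k N)
    (fun ν => ∑ y : ∀ i, Occ {v : V // comp v = i} (ν i),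
      ({∑ i, d i (ν i) (y i)} : Multiset ℂ))

end BH

open BH

/-- Suppose the vertex set `V` is partitioned as `V = V₁ ∪ ⋯ ∪ V_k` and
`A(G)` is block diagonal with respect to this partition with blocks `A(G₁),…,A(G_k)` (so
`G` is the disjoint union of graphs `G₁,…,G_k`), and suppose
`μ(G₁) = μ(G₂) = ⋯ = μ(G_k)`.  Then for every `N ≥ 1` the multiset of eigenvalues of
`H(G,N)` equals the multiset of values `Σ_{i ∈ [k], N_i ≠ 0} λ_{N_i}^{y_i}(G_i)`, where
`(N₁,…,N_k)` ranges over all tuples of nonnegative integers with `Σ_i N_i = N` and, for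
each `i` with `N_i ≠ 0`, `y_i` ranges over `{1,…,dim Z_{N_i}(G_i)}` (i.e. over all
eigenvalues of `H(G_i, N_i)` with multiplicity).  The partition is encoded by a
surjection `comp : V → Fin k` assigning to each vertex its component, and the component
graph `G_i` has vertex set `{v // comp v = i}` with the restricted adjacency matrix. -/
theorem bh_disjoint_union_spectrum
    {V : Type*} [Fintype V] [DecidableEq V] [Nonempty V]
    (k : ℕ) (hk : 1 ≤ k) (comp : V → Fin k) (hsurj : Function.Surjective comp)
    (A : Matrix V V ℂ) (hsymm : A.IsSymm)
    (h01 : ∀ i j, A i j = 0 ∨ A i j = 1)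
    (hblock : ∀ i j, comp i ≠ comp j → A i j = 0)
    (hmu : ∀ i : Fin k,
      BH.mu (A.submatrix (fun v : {v : V // comp v = i} => (v : V))
        (fun v : {v : V // comp v = i} => (v : V))) = BH.mu A)
    (N : ℕ) (hN : 1 ≤ N)
    (hinvG : ∀ ψ ∈ symmSubmodule V N,
      (shiftedHam A N).mulVecLin ψ ∈ symmSubmodule V N)
    (hinvC : ∀ (i : Fin k) (m : ℕ),
      ∀ ψ ∈ symmSubmodule {v : V // comp v = i} m,
        (shiftedHam (A.submatrix (fun v : {v : V // comp v = i} => (v : V))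
          (fun v : {v : V // comp v = i} => (v : V))) m).mulVecLin ψ
          ∈ symmSubmodule {v : V // comp v = i} m) :
    bhSpectrum A N hinvG
      = ∑ ν ∈ Finset.Nat.antidiagonalTuple k N,
          sumChoices
            (((List.finRange k).filter fun i => ν i ≠ 0).map fun i =>
              bhSpectrum
                (A.submatrix (fun v : {v : V // comp v = i} => (v : V))
                  (fun v : {v : V // comp v = i} => (v : V)))
                (ν i) (hinvC i (ν i))) := by
  have hd : ∀ (i : Fin k) (m : ℕ), ∃ d, BH.DiagBy (BH.occHam
      (A.submatrix (fun v : {v : V // comp v = i} => (v : V))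
        (fun v : {v : V // comp v = i} => (v : V))) (BH.mu A : ℂ) m) d := fun i m =>
    BH.exists_diagBy_occHam _ (hsymm.submatrix _) (fun a b => h01 _ _) _ m
  choose d hd using hd
  have hC : ∀ (i : Fin k) (m : ℕ), bhSpectrum (A.submatrix (fun v : {v : V // comp v = i} => (v : V))
        (fun v : {v : V // comp v = i} => (v : V))) m (hinvC i m) = ∑ j, ({d i m j} : Multiset ℂ) := by
    intro i m
    rw [BH.bhSpectrum_eq, hmu, (hd i m).roots]
  have hC0 : ∀ i : Fin k, bhSpectrum (A.submatrix (fun v : {v : V // comp v = i} => (v : V))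
        (fun v : {v : V // comp v = i} => (v : V))) 0 (hinvC i 0) = {0} := by
    intro i
    rw [BH.bhSpectrum_eq, BH.occHam_zero_roots]
  have hR : ∀ ν : Fin k → ℕ, sumChoices
            (((List.finRange k).filter fun i => ν i ≠ 0).map fun i =>
              bhSpectrum
                (A.submatrix (fun v : {v : V // comp v = i} => (v : V))
                  (fun v : {v : V // comp v = i} => (v : V)))
                (ν i) (hinvC i (ν i)))
      = ∑ y : ∀ i, BH.Occ {v : V // comp v = i} (ν i),
          ({∑ i, d i (ν i) (y i)} : Multiset ℂ) := by
    intro ν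
    rw [BH.sumChoices_filter]
    · simp only [hC]
      exact BH.sumChoices_pi k _ (fun i => d i (ν i))
    · intro i hi
      have h0 : ν i = 0 := by simpa using hi
      have : ∀ m, m = 0 → bhSpectrum (A.submatrix (fun v : {v : V // comp v = i} => (v : V))
        (fun v : {v : V // comp v = i} => (v : V))) m (hinvC i m) = {0} := by
        rintro m rfl
        exact hC0 i
      exact this _ h0
  rw [Finset.sum_congr rfl fun ν _ => hR ν]
  rw [BH.bhSpectrum_eq]
  exact BH.occHam_roots comp A hblock _ N d hd
end

section
/- Let G be a graph with K vertices (given by a symmetric 0-1 adjacency matrix) and let 1 ≤ N ≤ K. If λ_N^1(G) = 0 (i.e., the N-particle Bose–Hubbard model on G is frustration free), then θ_N(G) = Nμ(G), i.e., the ground energy of the XY Hamiltonian of G in the magnetization-N sector equals N times the smallest eigenvalue of A(G). -/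
namespace BH

open scoped Classical

variable {V : Type*} [Fintype V] [DecidableEq V]

/-- The hopping term `|01⟩⟨10| + |10⟩⟨01|` on the pair of qubits `(i,j)` (in one ordered
orientation; summing over both ordered pairs `(i,j)` and `(j,i)` yields the full
symmetric hopping term of the unordered pair `{i,j}`). -/
noncomputable def xyHop (V : Type*) [DecidableEq V] (i j : V) :
    Matrix (V → Fin 2) (V → Fin 2) ℂ :=
  Matrix.of fun x y =>
    if x i = 1 ∧ x j = 0 ∧ y i = 0 ∧ y j = 1 ∧ (∀ u, u ≠ i → u ≠ j → x u = y u)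
    then 1 else 0

/-- The XY Hamiltonian
`O_G = Σ_{{i,j} : i≠j, A i j = 1} (|01⟩⟨10| + |10⟩⟨01|)_{ij} + Σ_{i : A i i = 1} (|1⟩⟨1|)_i`
on the `V`-qubit space `(ℂ²)^{⊗V}`. -/
noncomputable def xyHam (A : Matrix V V ℂ) : Matrix (V → Fin 2) (V → Fin 2) ℂ :=
  (∑ p : V × V, if p.1 ≠ p.2 ∧ A p.1 p.2 = 1 then xyHop V p.1 p.2 else 0)
    + Matrix.of fun x y =>
        if x = y then
          ((Finset.univ.filter fun i : V => A i i = 1 ∧ x i = 1).card : ℂ)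
        else 0

/-- The magnetization-`N` sector `Wt_N(G)`: the span of the computational basis states
with exactly `N` qubits in state `|1⟩`. -/
def wtStates (V : Type*) [Fintype V] [DecidableEq V] (N : ℕ) :
    Set ((V → Fin 2) → ℂ) :=
  { ψ | ∀ x : V → Fin 2, (Finset.univ.filter fun i => x i = 1).card ≠ N → ψ x = 0 }

/-- `θ_N(G)`: the smallest eigenvalue of the XY Hamiltonian `O_G` restricted to the
magnetization-`N` sector. -/
noncomputable def theta (A : Matrix V V ℂ) (N : ℕ) : ℝ :=
  groundEnergy (xyHam A) (wtStates V N)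

end BH


namespace BH
open scoped Classical

variable {V : Type*} [Fintype V] [DecidableEq V]

/-- Rayleigh values. -/
def rayleigh {ι : Type*} [Fintype ι] (H : Matrix ι ι ℂ) (Z : Set (ι → ℂ)) : Set ℝ :=
  { r : ℝ | ∃ ψ ∈ Z, dotProduct (star ψ) ψ = 1 ∧
    r = (dotProduct (star ψ) (H.mulVec ψ)).re }

lemma self_dot {ι : Type*} [Fintype ι] (ψ : ι → ℂ) :
    dotProduct (star ψ) ψ = ((∑ i, ‖ψ i‖ ^ 2 : ℝ) : ℂ) := by
  simp only [dotProduct, Pi.star_apply]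
  push_cast
  refine Finset.sum_congr rfl fun i _ => ?_
  exact Complex.conj_mul' (ψ i)

lemma rayleigh_compact {ι : Type*} [Fintype ι] (H : Matrix ι ι ℂ) (Z : Set (ι → ℂ))
    (hZ : IsClosed Z) : IsCompact (rayleigh H Z) := by
  have h1 : rayleigh H Z = (fun ψ : ι → ℂ => (dotProduct (star ψ) (H.mulVec ψ)).re) ''
      (Z ∩ {ψ | dotProduct (star ψ) ψ = 1}) := by
    ext r
    simp only [rayleigh, Set.mem_ofPred_eq, Set.mem_image, Set.mem_inter_iff]
    constructor
    · rintro ⟨ψ, h, h', rfl⟩; exact ⟨ψ, ⟨h, h'⟩, rfl⟩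
    · rintro ⟨ψ, ⟨h, h'⟩, rfl⟩; exact ⟨ψ, h, h', rfl⟩
  rw [h1]
  apply IsCompact.image
  · apply Metric.isCompact_of_isClosed_isBounded
    · apply hZ.inter
      apply isClosed_eq
      · simp only [dotProduct]; fun_prop
      · fun_prop
    · apply (Metric.isBounded_closedBall (x := (0 : ι → ℂ)) (r := 1)).subset
      rintro ψ ⟨-, h⟩
      simp only [Set.mem_ofPred_eq] at h
      rw [self_dot] at h
      have h' : ∑ i, ‖ψ i‖ ^ 2 = 1 := by exact_mod_cast h
      rw [mem_closedBall_zero_iff, pi_norm_le_iff_of_nonneg zero_le_one]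
      intro i
      have := Finset.single_le_sum (f := fun i => ‖ψ i‖ ^ 2) (fun i _ => by positivity)
        (Finset.mem_univ i)
      simp only [h'] at this
      nlinarith [norm_nonneg (ψ i)]
  · simp only [dotProduct, Matrix.mulVec]; fun_prop

lemma mu_le (A : Matrix V V ℂ) (f : V → ℂ) :
    mu A * ∑ i, ‖f i‖ ^ 2 ≤ (dotProduct (star f) (A.mulVec f)).re := by
  set n := ∑ i, ‖f i‖ ^ 2 with hn
  have hn0 : 0 ≤ n := Finset.sum_nonneg fun i _ => by positivity
  rcases hn0.eq_or_lt with h | h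
  · have : f = 0 := by
      funext i
      have := (Finset.sum_eq_zero_iff_of_nonneg (fun i _ => by positivity)).1 (hn ▸ h.symm) i
        (Finset.mem_univ i)
      simpa using this
    rw [← h, this]; simp
  · have hs : (Real.sqrt n) ^ 2 = n := Real.sq_sqrt hn0
    have hs0 : 0 < Real.sqrt n := Real.sqrt_pos.2 h
    have key : mu A ≤ (dotProduct (star ((((Real.sqrt n)⁻¹ : ℝ) : ℂ) • f))
        (A.mulVec ((((Real.sqrt n)⁻¹ : ℝ) : ℂ) • f))).re := by
      apply csInf_le (rayleigh_compact A Set.univ isClosed_univ).bddBelow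
      refine ⟨_, Set.mem_univ _, ?_, rfl⟩
      rw [self_dot, Complex.ofReal_eq_one]
      simp only [Pi.smul_apply, smul_eq_mul, norm_mul, mul_pow, ← Finset.mul_sum, ← hn,
        Complex.norm_real, Real.norm_eq_abs, sq_abs]
      rw [inv_pow, hs]; field_simp
    rw [Matrix.mulVec_smul, star_smul, dotProduct_smul, smul_dotProduct, smul_smul] at key
    simp only [RCLike.star_def, Complex.conj_ofReal, smul_eq_mul] at key
    rw [← Complex.ofReal_mul, Complex.re_ofReal_mul, ← mul_inv, ← sq, hs] at key
    rw [inv_mul_eq_div, le_div_iff₀ h] at key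
    exact key

lemma onFactor_mulVec (N : ℕ) (A : Matrix V V ℂ) (w : Fin N) (φ : (Fin N → V) → ℂ)
    (x : Fin N → V) :
    (onFactor N A w).mulVec φ x = ∑ v, A (x w) v * φ (Function.update x w v) := by
  simp only [onFactor, Matrix.mulVec, dotProduct, Matrix.of_apply, ite_mul, one_mul, zero_mul]
  rw [← Finset.sum_filter]
  refine Finset.sum_nbij' (fun y => y w) (fun v => Function.update x w v) ?_ ?_ ?_ ?_ ?_
  · simp
  · intro v _
    simp only [Finset.mem_filter, Finset.mem_univ, true_and]
    intro u hu; simp [hu]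
  · intro y hy
    simp only [Finset.mem_filter, Finset.mem_univ, true_and] at hy
    funext u
    by_cases hu : u = w
    · subst hu; simp
    · simp [hu, hy u hu]
  · simp
  · intro y hy
    simp only [Finset.mem_filter, Finset.mem_univ, true_and] at hy
    congr 2
    funext u
    by_cases hu : u = w
    · subst hu; simp
    · simp [hu, hy u hu]

lemma onFactor_lower (N : ℕ) (A : Matrix V V ℂ) (w : Fin N) (φ : (Fin N → V) → ℂ) :
    mu A * ∑ x, ‖φ x‖ ^ 2 ≤ (dotProduct (star φ) ((onFactor N A w).mulVec φ)).re := by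
  have e := (Equiv.funSplitAt w V).symm
  set E := (Equiv.funSplitAt w V).symm with hE
  have hw : ∀ v r, E (v, r) w = v := by intro v r; simp [hE]
  have hu : ∀ v r v', Function.update (E (v, r)) w v' = E (v', r) := by
    intro v r v'
    funext u
    by_cases hu : u = w
    · subst hu; simp [hw]
    · simp [hu, hE]
  simp only [dotProduct, onFactor_mulVec]
  rw [← E.sum_comp, ← E.sum_comp, Fintype.sum_prod_type_right, Fintype.sum_prod_type_right,
    Finset.mul_sum, Complex.re_sum]
  refine Finset.sum_le_sum fun r _ => ?_
  simp only [hw, hu]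
  exact mu_le A fun v => φ (E (v, r))

/-- hopping part -/
noncomputable def hop (A : Matrix V V ℂ) (N : ℕ) : Matrix (Fin N → V) (Fin N → V) ℂ :=
  ∑ w : Fin N, onFactor N A w

lemma hop_lower (N : ℕ) (A : Matrix V V ℂ) (φ : (Fin N → V) → ℂ) :
    N * mu A * ∑ x, ‖φ x‖ ^ 2 ≤ (dotProduct (star φ) ((hop A N).mulVec φ)).re := by
  rw [hop, Matrix.sum_mulVec, dotProduct_sum, Complex.re_sum]
  calc N * mu A * ∑ x, ‖φ x‖ ^ 2 = ∑ w : Fin N, mu A * ∑ x, ‖φ x‖ ^ 2 := by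
        simp [mul_assoc]
    _ ≤ _ := Finset.sum_le_sum fun w _ => onFactor_lower N A w φ

/-- occupation -/
noncomputable def ind {N : ℕ} (x : Fin N → V) : V → Fin 2 :=
  fun i => if ∃ w, x w = i then 1 else 0

lemma ind_eq_one {N : ℕ} (x : Fin N → V) (i : V) : ind x i = 1 ↔ ∃ w, x w = i := by
  unfold ind; split_ifs with h <;> simp [h]

lemma ind_eq_zero {N : ℕ} (x : Fin N → V) (i : V) : ind x i = 0 ↔ ¬ ∃ w, x w = i := by
  unfold ind; split_ifs with h <;> simp [h]

lemma ind_filter {N : ℕ} (x : Fin N → V) :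
    (Finset.univ.filter fun i => ind x i = 1) = Finset.univ.image x := by
  ext i; simp [ind_eq_one]

lemma ind_card {N : ℕ} (x : Fin N → V) (hx : Function.Injective x) :
    (Finset.univ.filter fun i => ind x i = 1).card = N := by
  rw [ind_filter, Finset.card_image_of_injective _ hx]; simp

lemma ind_comp {N : ℕ} (x : Fin N → V) (σ : Equiv.Perm (Fin N)) : ind (x ∘ σ) = ind x := by
  funext i
  unfold ind
  have : (∃ w, (x ∘ σ) w = i) ↔ ∃ w, x w = i :=
    ⟨fun ⟨w, h⟩ => ⟨σ w, h⟩, fun ⟨w, h⟩ => ⟨σ.symm w, by simpa using h⟩⟩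
  simp only [this]

lemma exists_perm_s8 {N : ℕ} (x y : Fin N → V) (hx : Function.Injective x)
    (hy : Function.Injective y) (h : ind x = ind y) : ∃ σ : Equiv.Perm (Fin N), y = x ∘ σ := by
  have h1 : ∀ w, ∃ w', x w' = y w := by
    intro w
    rw [← ind_eq_one, h, ind_eq_one]
    exact ⟨w, rfl⟩
  choose g hg using h1
  have hgi : Function.Injective g := by
    intro a b hab
    apply hy
    rw [← hg, ← hg, hab]
  refine ⟨Equiv.ofBijective g (Finite.injective_iff_bijective.1 hgi), ?_⟩
  funext w
  simp [hg]

lemma exists_enum {N : ℕ} (s : V → Fin 2)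
    (hs : (Finset.univ.filter fun i => s i = 1).card = N) :
    ∃ x : Fin N → V, Function.Injective x ∧ ind x = s := by
  let e := (Finset.univ.filter fun i => s i = 1).equivFinOfCardEq hs
  refine ⟨fun w => (e.symm w : V), fun a b h => e.symm.injective (Subtype.ext h), ?_⟩
  funext i
  by_cases h : s i = 1
  · rw [h, ind_eq_one]
    exact ⟨e ⟨i, by simpa using h⟩, by simp⟩
  · have h0 : s i = 0 := by omega
    rw [h0, ind_eq_zero]
    rintro ⟨w, hw⟩
    have := (e.symm w).2
    rw [hw] at this
    simp [h0] at this

lemma fiber_card {N : ℕ} (s : V → Fin 2)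
    (hs : (Finset.univ.filter fun i => s i = 1).card = N) :
    (Finset.univ.filter fun x : Fin N → V => Function.Injective x ∧ ind x = s).card
      = N.factorial := by
  obtain ⟨x0, hx0, h0⟩ := exists_enum s hs
  have : (Finset.univ.filter fun x : Fin N → V => Function.Injective x ∧ ind x = s)
      = Finset.univ.image (fun σ : Equiv.Perm (Fin N) => x0 ∘ σ) := by
    ext x
    simp only [Finset.mem_filter, Finset.mem_univ, true_and, Finset.mem_image]
    constructor
    · rintro ⟨hx, h⟩
      obtain ⟨σ, hσ⟩ := exists_perm_s8 x0 x hx0 hx (h0.trans h.symm)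
      exact ⟨σ, hσ.symm⟩
    · rintro ⟨σ, rfl⟩
      exact ⟨hx0.comp σ.injective, by rw [ind_comp, h0]⟩
  rw [this, Finset.card_image_of_injective, Finset.card_univ, Fintype.card_perm, Fintype.card_fin]
  intro σ τ h
  ext w
  have := hx0 (congrFun h w)
  rw [this]

lemma sum_inj {N : ℕ} (f : (V → Fin 2) → ℂ)
    (hf : ∀ s : V → Fin 2, (Finset.univ.filter fun i => s i = 1).card ≠ N → f s = 0) :
    ∑ x : Fin N → V, (if Function.Injective x then f (ind x) else 0)
      = N.factorial * ∑ s, f s := by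
  rw [← Finset.sum_filter, ← Finset.sum_fiberwise _ (fun x => ind x), Finset.mul_sum]
  refine Finset.sum_congr rfl fun s _ => ?_
  rw [Finset.filter_filter]
  by_cases hs : (Finset.univ.filter fun i => s i = 1).card = N
  · rw [← fiber_card s hs, ← nsmul_eq_mul, ← Finset.sum_const]
    refine Finset.sum_congr rfl fun x hx => ?_
    rw [(Finset.mem_filter.1 hx).2.2]
  · rw [hf s hs, mul_zero]
    refine Finset.sum_eq_zero fun x hx => ?_
    rw [(Finset.mem_filter.1 hx).2.2, hf s hs]

/-- lift -/
noncomputable def lift (N : ℕ) (ψ : (V → Fin 2) → ℂ) : (Fin N → V) → ℂ :=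
  fun x => if Function.Injective x then ψ (ind x) else 0

lemma lift_norm (N : ℕ) (ψ : (V → Fin 2) → ℂ) (hψ : ψ ∈ wtStates V N) :
    dotProduct (star (lift N ψ)) (lift N ψ) = N.factorial * dotProduct (star ψ) ψ := by
  simp only [dotProduct]
  rw [← sum_inj]
  · refine Finset.sum_congr rfl fun x _ => ?_
    simp only [Pi.star_apply, lift]
    split_ifs <;> simp
  · intro s hs
    rw [hψ s hs, mul_zero]

lemma update_inj {N : ℕ} (x : Fin N → V) (hx : Function.Injective x) (w : Fin N) (v : V) :
    Function.Injective (Function.update x w v) ↔ (x w = v ∨ ind x v = 0) := by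
  rw [ind_eq_zero]
  constructor
  · intro h
    by_contra hc
    push Not at hc
    obtain ⟨h1, w', hw'⟩ := hc
    have hne : w' ≠ w := by rintro rfl; exact h1 hw'
    apply hne
    apply h
    simp [hne, hw']
  · rintro (rfl | h)
    · simpa using hx
    · push Not at h
      intro a b hab
      by_cases ha : a = w <;> by_cases hb : b = w
      · rw [ha, hb]
      · subst ha; simp [hb] at hab; exact absurd hab.symm (h b)
      · subst hb; simp [ha] at hab; exact absurd hab (h a)
      · simp [ha, hb] at hab; exact hx hab

lemma ind_update {N : ℕ} (x : Fin N → V) (hx : Function.Injective x) (w : Fin N) (v : V) :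
    ind (Function.update x w v) = Function.update (Function.update (ind x) (x w) 0) v 1 := by
  funext i
  by_cases hi : i = v
  · subst hi
    rw [Function.update_self, ind_eq_one]
    exact ⟨w, by simp⟩
  · rw [Function.update_of_ne hi]
    by_cases hw : i = x w
    · subst hw
      rw [Function.update_self, ind_eq_zero]
      rintro ⟨w', h⟩
      by_cases h' : w' = w
      · subst h'; simp at h; exact hi h.symm
      · simp [h'] at h; exact h' (hx h)
    · rw [Function.update_of_ne hw]
      unfold ind
      have : (∃ w', Function.update x w v w' = i) ↔ ∃ w', x w' = i := by
        constructor
        · rintro ⟨w', h⟩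
          by_cases h' : w' = w
          · subst h'; simp at h; exact absurd h.symm hi
          · exact ⟨w', by simpa [h'] using h⟩
        · rintro ⟨w', h⟩
          have h' : w' ≠ w := by rintro rfl; exact hw h.symm
          exact ⟨w', by simpa [h'] using h⟩
      simp only [this]

lemma xyHop_mulVec (i j : V) (hij : i ≠ j) (ψ : (V → Fin 2) → ℂ) (s : V → Fin 2) :
    (xyHop V i j).mulVec ψ s = if s i = 1 ∧ s j = 0 then
      ψ (Function.update (Function.update s i 0) j 1) else 0 := by
  simp only [xyHop, Matrix.mulVec, dotProduct, Matrix.of_apply, ite_mul, one_mul, zero_mul]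
  split_ifs with h
  · rw [Finset.sum_eq_single (Function.update (Function.update s i 0) j 1)]
    · rw [if_pos]
      refine ⟨h.1, h.2, by simp [hij], by simp, fun u hu hu' => by simp [hu, hu']⟩
    · intro y _ hy
      rw [if_neg]
      rintro ⟨_, _, h3, h4, h5⟩
      apply hy
      funext u
      by_cases hu' : u = j
      · subst hu'; simp [h4]
      · by_cases hu : u = i
        · subst hu; simp [hu', h3]
        · simp [hu, hu', h5 u hu hu']
    · simp
  · refine Finset.sum_eq_zero fun y _ => ?_
    rw [if_neg]
    rintro ⟨h1, h2, _⟩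
    exact h ⟨h1, h2⟩

lemma xyHam_mulVec (A : Matrix V V ℂ) (h01 : ∀ i j, A i j = 0 ∨ A i j = 1)
    (ψ : (V → Fin 2) → ℂ) (s : V → Fin 2) :
    (xyHam A).mulVec ψ s = ∑ i, if s i = 1 then ∑ j, A i j * (if i = j ∨ s j = 0 then
      ψ (Function.update (Function.update s i 0) j 1) else 0) else 0 := by
  have hd : (Matrix.of fun x y : V → Fin 2 =>
        if x = y then
          ((Finset.univ.filter fun i : V => A i i = 1 ∧ x i = 1).card : ℂ)
        else 0).mulVec ψ s = ∑ i, if s i = 1 then A i i * ψ s else 0 := by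
    simp only [Matrix.mulVec, dotProduct, Matrix.of_apply, ite_mul, zero_mul]
    rw [Finset.sum_ite_eq, if_pos (Finset.mem_univ _), Finset.card_filter]
    push_cast
    rw [Finset.sum_mul]
    refine Finset.sum_congr rfl fun i _ => ?_
    by_cases h : s i = 1 <;> rcases h01 i i with h' | h' <;> simp [h, h']
  rw [xyHam, Matrix.add_mulVec, Pi.add_apply, hd, Matrix.sum_mulVec, Finset.sum_apply,
    Fintype.sum_prod_type, ← Finset.sum_add_distrib]
  refine Finset.sum_congr rfl fun i _ => ?_
  have hi : (∑ j, (if (i, j).1 ≠ (i, j).2 ∧ A (i, j).1 (i, j).2 = 1 then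
      xyHop V (i, j).1 (i, j).2 else 0).mulVec ψ s) = ∑ j, if i ≠ j ∧ s i = 1 ∧ s j = 0 then
      A i j * ψ (Function.update (Function.update s i 0) j 1) else 0 := by
    refine Finset.sum_congr rfl fun j _ => ?_
    by_cases hij : i = j
    · simp [hij]
    · rcases h01 i j with h' | h'
      · simp [h']
      · simp only [h', ne_eq, hij, not_false_eq_true, and_self, if_true, true_and, one_mul]
        exact xyHop_mulVec i j hij ψ s
  rw [hi]
  by_cases h : s i = 1
  · simp only [h, if_true, true_and]
    have : A i i * ψ s = ∑ j, if i = j then A i j * ψ s else 0 := by simp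
    rw [this, ← Finset.sum_add_distrib]
    refine Finset.sum_congr rfl fun j _ => ?_
    by_cases hij : i = j
    · subst hij
      have : Function.update s i 1 = s := by rw [← h]; simp
      simp [this]
    · simp [hij]
  · simp [h]

lemma hop_lift (A : Matrix V V ℂ) (h01 : ∀ i j, A i j = 0 ∨ A i j = 1) (N : ℕ)
    (ψ : (V → Fin 2) → ℂ) (x : Fin N → V) (hx : Function.Injective x) :
    (hop A N).mulVec (lift N ψ) x = (xyHam A).mulVec ψ (ind x) := by
  rw [hop, Matrix.sum_mulVec, Finset.sum_apply, xyHam_mulVec A h01, ← Finset.sum_filter,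
    ind_filter, Finset.sum_image (fun a _ b _ h => hx h)]
  refine Finset.sum_congr rfl fun w _ => ?_
  rw [onFactor_mulVec]
  refine Finset.sum_congr rfl fun v _ => ?_
  simp only [lift, update_inj x hx, ind_update x hx]

lemma hop_quad (A : Matrix V V ℂ) (h01 : ∀ i j, A i j = 0 ∨ A i j = 1) (N : ℕ)
    (ψ : (V → Fin 2) → ℂ) (hψ : ψ ∈ wtStates V N) :
    dotProduct (star (lift N ψ)) ((hop A N).mulVec (lift N ψ))
      = N.factorial * dotProduct (star ψ) ((xyHam A).mulVec ψ) := by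
  simp only [dotProduct]
  rw [← sum_inj]
  · refine Finset.sum_congr rfl fun x _ => ?_
    by_cases hx : Function.Injective x
    · rw [hop_lift A h01 N ψ x hx]; simp [lift, hx]
    · simp [lift, hx]
  · intro s hs
    rw [Pi.star_apply, hψ s hs, star_zero, zero_mul]

lemma exists_lift (N : ℕ) (φ : (Fin N → V) → ℂ) (hφ : φ ∈ symmStates V N)
    (h0 : ∀ x, ¬ Function.Injective x → φ x = 0) : ∃ ψ ∈ wtStates V N, lift N ψ = φ := by
  refine ⟨fun s => if h : ∃ x : Fin N → V, Function.Injective x ∧ ind x = s then φ h.choose else 0,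
    ?_, ?_⟩
  · intro s hs
    simp only
    rw [dif_neg]
    rintro ⟨x, hx, rfl⟩
    exact hs (ind_card x hx)
  · funext x
    by_cases hx : Function.Injective x
    · have h : ∃ y : Fin N → V, Function.Injective y ∧ ind y = ind x := ⟨x, hx, rfl⟩
      simp only [lift, hx, if_true]
      rw [dif_pos h]
      obtain ⟨σ, hσ⟩ := exists_perm_s8 _ x h.choose_spec.1 hx h.choose_spec.2
      conv_rhs => rw [hσ]
      exact (hφ σ _).symm
    · simp [lift, hx, h0 x hx]

lemma interaction_quad (N : ℕ) (φ : (Fin N → V) → ℂ) :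
    dotProduct (star φ) ((interaction V N).mulVec φ) = ((∑ x : Fin N → V,
      (((Finset.univ : Finset (Fin N × Fin N)).filter
          fun p => p.1 ≠ p.2 ∧ x p.1 = x p.2).card : ℝ) * ‖φ x‖ ^ 2 : ℝ) : ℂ) := by
  simp only [dotProduct]
  push_cast
  refine Finset.sum_congr rfl fun x _ => ?_
  simp only [interaction, Matrix.mulVec, dotProduct, Matrix.of_apply, ite_mul, zero_mul]
  rw [Finset.sum_ite_eq, if_pos (Finset.mem_univ _), ← Complex.conj_mul']
  simp only [Pi.star_apply, RCLike.star_def]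
  ring

lemma symm_closed (N : ℕ) : IsClosed (symmStates V N) := by
  have : symmStates V N = ⋂ σ : Equiv.Perm (Fin N), ⋂ x : Fin N → V,
      {ψ | ψ (x ∘ σ) = ψ x} := by
    ext; simp [symmStates]
  rw [this]
  exact isClosed_iInter fun σ => isClosed_iInter fun x =>
    isClosed_eq (by fun_prop) (by fun_prop)

lemma exists_ground [Nonempty V] (A : Matrix V V ℂ) (N : ℕ) (hff : lambda1 A N = 0) :
    ∃ φ ∈ symmStates V N, dotProduct (star φ) φ = 1 ∧
      (∀ x, ¬ Function.Injective x → φ x = 0) ∧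
      (dotProduct (star φ) ((hop A N).mulVec φ)).re = N * mu A := by
  have hne : (rayleigh (bhHam A N - ((N : ℂ) * (mu A : ℂ)) • 1) (symmStates V N)).Nonempty := by
    obtain ⟨v⟩ := ‹Nonempty V›
    refine ⟨_, Pi.single (fun _ => v) 1, ?_, ?_, rfl⟩
    · intro σ x
      have : x ∘ σ = (fun _ => v) ↔ x = fun _ => v := by
        constructor
        · intro h; funext w; simpa using congrFun h (σ.symm w)
        · rintro rfl; rfl
      simp only [Pi.single_apply, this]
    · rw [self_dot]
      norm_cast
      rw [Finset.sum_eq_single (fun _ => v)]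
      · simp
      · intro y _ hy; simp [Pi.single_apply, hy]
      · simp
  have hmem := (rayleigh_compact (bhHam A N - ((N : ℂ) * (mu A : ℂ)) • 1) _
    (symm_closed N)).sInf_mem hne
  have h0 : sInf (rayleigh (bhHam A N - ((N : ℂ) * (mu A : ℂ)) • 1) (symmStates V N)) = 0 := hff
  rw [h0] at hmem
  obtain ⟨φ, hφ, hφ1, h⟩ := hmem
  have hn : ∑ x, ‖φ x‖ ^ 2 = 1 := by rw [self_dot] at hφ1; exact_mod_cast hφ1
  rw [Matrix.sub_mulVec, Matrix.smul_mulVec, Matrix.one_mulVec, dotProduct_sub, dotProduct_smul,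
    hφ1, bhHam, Matrix.add_mulVec, dotProduct_add, interaction_quad] at h
  have hl := hop_lower N A φ
  rw [hn, mul_one] at hl
  have hh : (∑ w : Fin N, onFactor N A w) = hop A N := rfl
  rw [hh] at h
  simp only [Complex.sub_re, Complex.add_re, smul_eq_mul, mul_one, Complex.ofReal_re] at h
  have hc : ((N : ℂ) * (mu A : ℂ)).re = N * mu A := by
    rw [← Complex.ofReal_natCast, ← Complex.ofReal_mul, Complex.ofReal_re]
  rw [hc] at h
  have hpos : ∀ x ∈ (Finset.univ : Finset (Fin N → V)), 0 ≤
      (((Finset.univ : Finset (Fin N × Fin N)).filter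
          fun p => p.1 ≠ p.2 ∧ x p.1 = x p.2).card : ℝ) * ‖φ x‖ ^ 2 := fun x _ => by positivity
  have hs := Finset.sum_nonneg hpos
  refine ⟨φ, hφ, hφ1, ?_, by linarith⟩
  intro x hx
  have hz := (Finset.sum_eq_zero_iff_of_nonneg hpos).1 (by linarith) x (Finset.mem_univ x)
  rcases mul_eq_zero.1 hz with h1 | h1
  · exfalso
    apply hx
    intro a b hab
    by_contra hne
    have h2 := Finset.card_eq_zero.1 (Nat.cast_eq_zero.1 h1)
    have : (a, b) ∈ (∅ : Finset (Fin N × Fin N)) := by rw [← h2]; simp [hne, hab]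
    simp at this
  · simpa using h1

end BH

/-- Let `G` be a graph with `K` vertices (given by a symmetric 0-1
adjacency matrix) and let `1 ≤ N ≤ K`.  If `λ_N^1(G) = 0` (i.e., the `N`-particle
Bose–Hubbard model on `G` is frustration free), then `θ_N(G) = Nμ(G)`: the ground energy
of the XY Hamiltonian of `G` in the magnetization-`N` sector equals `N` times the
smallest eigenvalue of `A(G)`. -/
theorem xy_frustration_free
    {V : Type*} [Fintype V] [DecidableEq V] [Nonempty V]
    (A : Matrix V V ℂ) (hsymm : A.IsSymm)
    (h01 : ∀ i j, A i j = 0 ∨ A i j = 1)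
    (N : ℕ) (hN1 : 1 ≤ N) (hNK : N ≤ Fintype.card V)
    (hff : BH.lambda1 A N = 0) :
    BH.theta A N = N * BH.mu A := by
  have hfac : (0 : ℝ) < N.factorial := by exact_mod_cast N.factorial_pos
  apply IsLeast.csInf_eq
  constructor
  · obtain ⟨φ, hφ, hφ1, hφ0, hq⟩ := BH.exists_ground A N hff
    obtain ⟨ψ, hψ, rfl⟩ := BH.exists_lift N φ hφ hφ0
    rw [BH.lift_norm N ψ hψ] at hφ1
    rw [BH.hop_quad A h01 N ψ hψ] at hq
    have hsq : ((Real.sqrt N.factorial : ℝ) : ℂ) * ((Real.sqrt N.factorial : ℝ) : ℂ)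
        = (N.factorial : ℂ) := by
      rw [← Complex.ofReal_mul, Real.mul_self_sqrt hfac.le, Complex.ofReal_natCast]
    refine ⟨((Real.sqrt N.factorial : ℝ) : ℂ) • ψ, ?_, ?_, ?_⟩
    · intro x hx
      simp [hψ x hx]
    · rw [star_smul, dotProduct_smul, smul_dotProduct, smul_smul]
      simp only [RCLike.star_def, Complex.conj_ofReal, smul_eq_mul]
      rw [hsq, hφ1]
    · rw [Matrix.mulVec_smul, star_smul, dotProduct_smul, smul_dotProduct, smul_smul]
      simp only [RCLike.star_def, Complex.conj_ofReal, smul_eq_mul]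
      rw [hsq, hq]
  · rintro r ⟨ψ, hψ, h1, rfl⟩
    have h := BH.hop_lower N A (BH.lift N ψ)
    have hn := BH.lift_norm N ψ hψ
    rw [h1, mul_one, BH.self_dot] at hn
    have hn' : ∑ x, ‖BH.lift N ψ x‖ ^ 2 = (N.factorial : ℝ) := by exact_mod_cast hn
    rw [hn', BH.hop_quad A h01 N ψ hψ, ← Complex.ofReal_natCast, Complex.re_ofReal_mul] at h
    nlinarith
end
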